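/- arXiv:1909.02334 — 12 statements merged into one kernel-verified Lean document; each statement's English description precedes it below -/
import Mathlib

section
/- Let n, m ≥ 2, let A ∈ ℝ^{n×m} have nonnegative entries with no zero row and no zero column, and let p ∈ ℝ^n, q ∈ ℝ^m have strictly positive entries with ∑_{i=1}^n p_i = ∑_{j=1}^m q_j. Suppose ε_p(A) > 0 and, setting w = V(A)/min_i p_i, suppose w < 1, ε_p(A) < (1+w)/(1−w), and 2w(1 + w·r(w, ε_p(A))) ≤ ε_p(A). Then the iterates X^{(s)} of the alternating balancing procedure are well defined and there exists α ∈ (0,1) such that V(X^{(2t)}) ≤ (1−α)^t · V(A) for every t ≥ 0; in particular the sequence (X^{(s)}) converges to the set of matrices with row sums p and column sums q at the speed of a geometric progression. -/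
open Finset

/-- Lyapunov function `V(X) = ∑ᵢ |∑ⱼ xᵢⱼ − pᵢ| + ∑ⱼ |∑ᵢ xᵢⱼ − qⱼ|`. -/
noncomputable def lyap {n m : ℕ} (p : Fin n → ℝ) (q : Fin m → ℝ)
    (X : Matrix (Fin n) (Fin m) ℝ) : ℝ :=
  ∑ i, |(∑ j, X i j) - p i| + ∑ j, |(∑ i, X i j) - q j|

/-- Row-balancing step `X'ᵢⱼ = pᵢ xᵢⱼ / ∑ₗ xᵢₗ`. -/
noncomputable def rowBal {n m : ℕ} (p : Fin n → ℝ) (X : Matrix (Fin n) (Fin m) ℝ) :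
    Matrix (Fin n) (Fin m) ℝ :=
  fun i j => p i * X i j / ∑ l, X i l

/-- Column-balancing step `X''ᵢⱼ = qⱼ xᵢⱼ / ∑ₖ xₖⱼ`. -/
noncomputable def colBal {n m : ℕ} (q : Fin m → ℝ) (X : Matrix (Fin n) (Fin m) ℝ) :
    Matrix (Fin n) (Fin m) ℝ :=
  fun i j => q j * X i j / ∑ k, X k j

/-- Alternating balancing procedure: `X⁽⁰⁾ = A`, odd steps row-balance, even steps
column-balance. -/
noncomputable def iterBal {n m : ℕ} (p : Fin n → ℝ) (q : Fin m → ℝ)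
    (A : Matrix (Fin n) (Fin m) ℝ) : ℕ → Matrix (Fin n) (Fin m) ℝ
  | 0 => A
  | s + 1 => if s % 2 = 0 then rowBal p (iterBal p q A s) else colBal q (iterBal p q A s)

/-- `ε_p(X)`: minimum over nonempty proper subsets `Ĩ ⊊ {1,…,n}`, `J̃ ⊊ {1,…,m}` of
`min_{j∈J̃} ∑_{i∉Ĩ} xᵢⱼ/(∑ₖ xₖⱼ) + min_{j∉J̃} ∑_{i∈Ĩ} xᵢⱼ/(∑ₖ xₖⱼ)`. -/
noncomputable def epsP {n m : ℕ} (X : Matrix (Fin n) (Fin m) ℝ) : ℝ :=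
  sInf { v : ℝ | ∃ (I : Finset (Fin n)) (J : Finset (Fin m)),
    I.Nonempty ∧ I ≠ Finset.univ ∧ J.Nonempty ∧ J ≠ Finset.univ ∧
    v = sInf ((fun j => ∑ i ∈ Iᶜ, X i j / ∑ k, X k j) '' (J : Set (Fin m))) +
        sInf ((fun j => ∑ i ∈ I, X i j / ∑ k, X k j) '' ((Jᶜ : Finset (Fin m)) : Set (Fin m))) }

/-- `r(w, ε) = (4 − (1+ε)(1−w)²) / ((1 + εw − (1+ε)w²)(1−w))`. -/
noncomputable def rF (w ε : ℝ) : ℝ :=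
  (4 - (1 + ε) * (1 - w) ^ 2) / ((1 + ε * w - (1 + ε) * w ^ 2) * (1 - w))

/-- Frobenius norm. -/
noncomputable def frob {n m : ℕ} (X : Matrix (Fin n) (Fin m) ℝ) : ℝ :=
  Real.sqrt (∑ i, ∑ j, (X i j) ^ 2)

/-- Entrywise 1-norm `‖X‖₁ = ∑ᵢⱼ |xᵢⱼ|`. -/
noncomputable def norm1 {n m : ℕ} (X : Matrix (Fin n) (Fin m) ℝ) : ℝ :=
  ∑ i, ∑ j, |X i j|

theorem lyap_transpose {n m : ℕ} (p : Fin n → ℝ) (q : Fin m → ℝ)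
    (X : Matrix (Fin n) (Fin m) ℝ) : lyap q p X.transpose = lyap p q X := by
  simp only [lyap, Matrix.transpose_apply]; ring

theorem colBal_transpose {n m : ℕ} (q : Fin m → ℝ)
    (X : Matrix (Fin n) (Fin m) ℝ) : colBal q X = (rowBal q X.transpose).transpose := by
  ext i j; simp [colBal, rowBal, Matrix.transpose_apply]

theorem rowBal_row {n m : ℕ} (p : Fin n → ℝ) (X : Matrix (Fin n) (Fin m) ℝ)
    (hr : ∀ i, 0 < ∑ j, X i j) (i : Fin n) : ∑ j, rowBal p X i j = p i := by
  simp only [rowBal]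
  rw [← Finset.sum_div, ← Finset.mul_sum]
  exact mul_div_cancel_right₀ _ (hr i).ne'

theorem rowBal_mono {n m : ℕ} (p : Fin n → ℝ) (q : Fin m → ℝ) (X : Matrix (Fin n) (Fin m) ℝ)
    (hX : ∀ i j, 0 ≤ X i j) (hr : ∀ i, 0 < ∑ j, X i j) :
    lyap p q (rowBal p X) ≤ lyap p q X := by
  have h1 : ∀ i, ∑ j, |rowBal p X i j - X i j| = |(∑ j, X i j) - p i| := by
    intro i
    have h : ∀ j, |rowBal p X i j - X i j| = |p i - ∑ l, X i l| / (∑ l, X i l) * X i j := by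
      intro j
      have : rowBal p X i j - X i j = (p i - ∑ l, X i l) / (∑ l, X i l) * X i j := by
        have := (hr i).ne'
        simp only [rowBal]; field_simp
      rw [this, abs_mul, abs_div, abs_of_pos (hr i), abs_of_nonneg (hX i j)]
    simp only [h]
    rw [← Finset.mul_sum, div_mul_cancel₀ _ (hr i).ne', abs_sub_comm]
  have h2 : ∑ j, |(∑ i, rowBal p X i j) - q j| ≤
      ∑ j, (∑ i, |rowBal p X i j - X i j| + |(∑ i, X i j) - q j|) := by
    apply Finset.sum_le_sum
    intro j _
    have e : (∑ i, rowBal p X i j) - q j =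
        (∑ i, (rowBal p X i j - X i j)) + ((∑ i, X i j) - q j) := by
      rw [Finset.sum_sub_distrib]; ring
    rw [e]
    exact (abs_add_le _ _).trans (add_le_add (Finset.abs_sum_le_sum_abs _ _) le_rfl)
  rw [Finset.sum_add_distrib, Finset.sum_comm] at h2
  simp only [h1] at h2
  have h3 : ∑ i, |(∑ j, rowBal p X i j) - p i| = 0 := by
    apply Finset.sum_eq_zero; intro i _; rw [rowBal_row p X hr]; simp
  unfold lyap
  rw [h3]; linarith

theorem colBal_mono {n m : ℕ} (p : Fin n → ℝ) (q : Fin m → ℝ) (X : Matrix (Fin n) (Fin m) ℝ)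
    (hX : ∀ i j, 0 ≤ X i j) (hc : ∀ j, 0 < ∑ i, X i j) :
    lyap p q (colBal q X) ≤ lyap p q X := by
  rw [colBal_transpose, ← lyap_transpose, Matrix.transpose_transpose, ← lyap_transpose p q X]
  exact rowBal_mono q p X.transpose (fun i j => hX j i) hc

/-- Dobrushin contraction -/
theorem dob {n m : ℕ} (P : Fin n → Fin m → ℝ) (y : Fin m → ℝ) (d : ℝ) (hm : 2 ≤ m)
    (hP : ∀ i j, 0 ≤ P i j) (hs : ∀ j, ∑ i, P i j = 1)
    (hd : ∀ j j', ∃ i, d ≤ P i j ∧ d ≤ P i j') (hy : ∑ j, y j = 0) :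
    ∑ i, |∑ j, P i j * y j| ≤ (1 - d) * ∑ j, |y j| := by
  have : Nonempty (Fin m) := ⟨⟨0, by omega⟩⟩
  set s : Fin n → ℝ := fun i => if 0 ≤ ∑ j, P i j * y j then 1 else -1 with hsdef
  have hs1 : ∀ i, |∑ j, P i j * y j| = s i * ∑ j, P i j * y j := by
    intro i
    simp only [hsdef]
    split_ifs with h
    · rw [abs_of_nonneg h]; ring
    · rw [abs_of_neg (not_le.1 h)]; ring
  have hs2 : ∀ i, |s i| = 1 := by
    intro i; simp only [hsdef]; split_ifs <;> simp
  set g : Fin m → ℝ := fun j => ∑ i, s i * P i j with hg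
  have e : ∑ i, |∑ j, P i j * y j| = ∑ j, g j * y j := by
    simp only [hs1, hg, Finset.mul_sum, Finset.sum_mul]
    rw [Finset.sum_comm]
    exact Finset.sum_congr rfl fun j _ => Finset.sum_congr rfl fun i _ => by ring
  have hgd : ∀ j j', g j - g j' ≤ 2 * (1 - d) := by
    intro j j'
    obtain ⟨i0, h1, h2⟩ := hd j j'
    have a1 : g j - g j' ≤ ∑ i, (P i j + P i j' - if i = i0 then 2 * d else 0) := by
      simp only [hg]
      rw [← Finset.sum_sub_distrib]
      apply Finset.sum_le_sum
      intro i _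
      rw [← mul_sub]
      have b1 : s i * (P i j - P i j') ≤ |P i j - P i j'| := by
        refine (le_abs_self _).trans ?_
        rw [abs_mul, hs2, one_mul]
      refine b1.trans ?_
      split_ifs with h
      · subst h; rw [abs_le]; constructor <;> linarith
      · have := hP i j; have := hP i j'
        rw [abs_le]; constructor <;> linarith
    rw [Finset.sum_sub_distrib, Finset.sum_add_distrib, hs, hs] at a1
    simp at a1
    linarith
  obtain ⟨j1, h1⟩ := Finite.exists_max g
  obtain ⟨j2, h2⟩ := Finite.exists_min g
  rw [e]
  have e2 : ∑ j, g j * y j = ∑ j, (g j - (g j1 + g j2) / 2) * y j := by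
    simp only [sub_mul]
    rw [Finset.sum_sub_distrib, ← Finset.mul_sum, hy]; ring
  rw [e2, Finset.mul_sum]
  apply Finset.sum_le_sum
  intro j _
  refine (le_abs_self _).trans ?_
  rw [abs_mul]
  apply mul_le_mul_of_nonneg_right _ (abs_nonneg _)
  have := hgd j1 j2
  have := h1 j
  have := h2 j
  rw [abs_le]; constructor <;> linarith

theorem chain {n : ℕ} (x : Fin n → ℝ) (R : ℝ) (hR : 1 ≤ R) (hx : ∀ i, 0 < x i)
    (h : ∀ I : Finset (Fin n), I.Nonempty → I ≠ Finset.univ →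
      ∃ i ∈ I, ∃ k, k ∉ I ∧ x i < R * x k) (i k : Fin n) : x i ≤ R ^ n * x k := by
  have key : ∀ d : ℕ, (Finset.univ.filter fun k => x i ≤ R ^ d * x k) = Finset.univ ∨
      d + 1 ≤ (Finset.univ.filter fun k => x i ≤ R ^ d * x k).card := by
    intro d
    induction d with
    | zero =>
      right
      have : i ∈ (Finset.univ.filter fun k => x i ≤ R ^ 0 * x k) := by simp
      exact Finset.card_pos.2 ⟨i, this⟩
    | succ d ih =>
      have hsub : (Finset.univ.filter fun k => x i ≤ R ^ d * x k) ⊆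
          (Finset.univ.filter fun k => x i ≤ R ^ (d+1) * x k) := by
        intro k hk
        simp only [Finset.mem_filter, Finset.mem_univ, true_and] at hk ⊢
        refine hk.trans (mul_le_mul_of_nonneg_right ?_ (hx k).le)
        exact pow_le_pow_right₀ hR (by omega)
      by_cases hu : (Finset.univ.filter fun k => x i ≤ R ^ d * x k) = Finset.univ
      · left
        rw [hu] at hsub
        exact Finset.univ_subset_iff.1 hsub
      · right
        have h3 := ih.resolve_left hu
        obtain ⟨a, ha, b, hb, hab⟩ := h _ (Finset.card_pos.1 (by omega)) hu
        have hlt : (Finset.univ.filter fun k => x i ≤ R ^ d * x k) ⊂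
          (Finset.univ.filter fun k => x i ≤ R ^ (d+1) * x k) := by
          rw [Finset.ssubset_iff_of_subset hsub]
          refine ⟨b, ?_, hb⟩
          simp only [Finset.mem_filter, Finset.mem_univ, true_and] at ha ⊢
          have : R ^ d * x a ≤ R ^ d * (R * x b) :=
            mul_le_mul_of_nonneg_left hab.le (by positivity)
          rw [pow_succ]; linarith
        have := Finset.card_lt_card hlt
        omega
  have hu : (Finset.univ.filter fun k => x i ≤ R ^ n * x k) = Finset.univ := by
    rcases key n with h | h
    · exact h
    · have := Finset.card_le_univ (Finset.univ.filter fun k => x i ≤ R ^ n * x k)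
      simp only [Fintype.card_fin] at this
      omega
  have : k ∈ (Finset.univ.filter fun k => x i ≤ R ^ n * x k) := by rw [hu]; simp
  simpa using this

/-- subset discrepancy is bounded by the Lyapunov function -/
theorem lyap_sub {n m : ℕ} (p : Fin n → ℝ) (q : Fin m → ℝ) (X : Matrix (Fin n) (Fin m) ℝ)
    (I : Finset (Fin n)) (J : Finset (Fin m)) :
    |(∑ j ∈ J, q j - ∑ i ∈ I, p i) - (∑ j ∈ J, ∑ i, X i j - ∑ i ∈ I, ∑ j, X i j)| ≤
      lyap p q X := by
  have e : (∑ j ∈ J, q j - ∑ i ∈ I, p i) - (∑ j ∈ J, ∑ i, X i j - ∑ i ∈ I, ∑ j, X i j) =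
      (∑ i ∈ I, ((∑ j, X i j) - p i)) - ∑ j ∈ J, ((∑ i, X i j) - q j) := by
    rw [Finset.sum_sub_distrib, Finset.sum_sub_distrib]; ring
  rw [e, lyap]
  refine (abs_sub _ _).trans (add_le_add ?_ ?_)
  · exact (Finset.abs_sum_le_sum_abs _ _).trans
      (Finset.sum_le_sum_of_subset_of_nonneg (Finset.subset_univ _) fun _ _ _ => abs_nonneg _)
  · exact (Finset.abs_sum_le_sum_abs _ _).trans
      (Finset.sum_le_sum_of_subset_of_nonneg (Finset.subset_univ _) fun _ _ _ => abs_nonneg _)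

/-- columns touching I -/
noncomputable def nbr {n m : ℕ} (A : Matrix (Fin n) (Fin m) ℝ) (I : Finset (Fin n)) :
    Finset (Fin m) := by
  classical exact Finset.univ.filter fun j => ∃ i ∈ I, A i j ≠ 0

theorem mem_nbr {n m : ℕ} (A : Matrix (Fin n) (Fin m) ℝ) (I : Finset (Fin n)) (j : Fin m) :
    j ∈ nbr A I ↔ ∃ i ∈ I, A i j ≠ 0 := by
  classical simp [nbr]

theorem nbr_split {n m : ℕ} (A X : Matrix (Fin n) (Fin m) ℝ) (I : Finset (Fin n))
    (h0 : ∀ i j, A i j = 0 → X i j = 0) :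
    ∑ j ∈ nbr A I, ∑ i, X i j - ∑ i ∈ I, ∑ j, X i j = ∑ j ∈ nbr A I, ∑ i ∈ Iᶜ, X i j := by
  have h1 : ∑ i ∈ I, ∑ j, X i j = ∑ j ∈ nbr A I, ∑ i ∈ I, X i j := by
    rw [Finset.sum_comm]
    symm
    apply Finset.sum_congr rfl
    intro i hi
    apply Finset.sum_subset (Finset.subset_univ _)
    intro j _ hj
    rw [mem_nbr] at hj
    push Not at hj
    exact h0 i j (hj i hi)
  rw [h1, ← Finset.sum_sub_distrib]
  apply Finset.sum_congr rfl
  intro j _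
  rw [← Finset.sum_add_sum_compl I]; ring

theorem gap {n m : ℕ} (A : Matrix (Fin n) (Fin m) ℝ) (p : Fin n → ℝ) (q : Fin m → ℝ)
    (V η : ℝ) (hη : 0 < η) (hV : 0 ≤ V) (hA : ∀ i j, 0 ≤ A i j) (hq : ∀ j, 0 < q j)
    (hmar : ∀ I : Finset (Fin n), I.Nonempty → I ≠ Finset.univ →
      ∑ i ∈ I, p i + V + η ≤ ∑ j ∈ nbr A I, q j)
    (a M : ℝ) (ha : 0 < a) (hM : 0 < M)
    (haA : ∀ i j, A i j ≠ 0 → a ≤ A i j) (hAM : ∀ i j, A i j ≤ M) :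
    ∃ R : ℝ, 1 ≤ R ∧ ∀ (x : Fin n → ℝ) (y : Fin m → ℝ), (∀ i, 0 < x i) → (∀ j, 0 < y j) →
      lyap p q (fun i j => x i * A i j * y j) ≤ V → ∀ i k, x i ≤ R * x k := by
  set B := ∑ j, q j + V with hB
  have hB0 : 0 ≤ B := add_nonneg (Finset.sum_nonneg fun j _ => (hq j).le) hV
  set τ := η / (n * m + 1) with hτ
  have hτ0 : 0 < τ := by positivity
  set R := B * M / (a * τ) + 1 with hR
  have hR1 : 1 ≤ R := by
    have : 0 ≤ B * M / (a * τ) := by positivity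
    linarith
  have hRb : B * M ≤ R * a * τ := by
    have : R * a * τ = B * M + a * τ := by
      rw [hR]; field_simp
    have : 0 < a * τ := by positivity
    linarith
  refine ⟨R ^ n, one_le_pow₀ hR1, ?_⟩
  intro x y hx hy hL i k
  apply chain x R hR1 hx
  intro I hI hIu
  by_contra hcon
  push Not at hcon
  set X : Matrix (Fin n) (Fin m) ℝ := fun i j => x i * A i j * y j with hX
  have hX0 : ∀ i j, 0 ≤ X i j := fun i j =>
    mul_nonneg (mul_nonneg (hx i).le (hA i j)) (hy j).le
  have hcol : ∀ j, ∑ i, X i j ≤ B := by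
    intro j
    have h1 : |(∑ i, X i j) - q j| ≤ lyap p q X := by
      have := Finset.single_le_sum (f := fun j => |(∑ i, X i j) - q j|)
        (fun j _ => abs_nonneg _) (Finset.mem_univ j)
      have h3 : 0 ≤ ∑ i, |(∑ j, X i j) - p i| := Finset.sum_nonneg fun _ _ => abs_nonneg _
      simp only [lyap]; linarith
    have h2 := Finset.single_le_sum (f := q) (fun j _ => (hq j).le) (Finset.mem_univ j)
    have := (le_abs_self _).trans h1
    rw [hB]; linarith
  have hsmall : ∀ j ∈ nbr A I, ∀ k ∈ Iᶜ, X k j ≤ τ := by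
    intro j hj k hk
    obtain ⟨i, hi, hij⟩ := (mem_nbr A I j).1 hj
    have h1 := hcon i hi k (Finset.mem_compl.1 hk)
    have h2 : X i j ≤ B :=
      (Finset.single_le_sum (f := fun i => X i j) (fun i _ => hX0 i j)
        (Finset.mem_univ i)).trans (hcol j)
    have h3 : R * x k * a * y j ≤ B := by
      refine le_trans ?_ h2
      have := haA i j hij
      have := hx k
      have := hy j
      simp only [hX]
      gcongr
      exact (hx i).le
    have h4 : R * a * X k j ≤ B * M := by
      have : R * a * X k j = R * x k * a * y j * A k j := by simp only [hX]; ring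
      rw [this]
      exact mul_le_mul h3 (hAM k j) (hA k j) hB0
    have h5 : R * a * X k j ≤ R * a * τ := h4.trans hRb
    exact le_of_mul_le_mul_left h5 (by positivity)
  have hs := nbr_split A X I (fun i j h => by simp [hX, h])
  have hsum : ∑ j ∈ nbr A I, ∑ i ∈ Iᶜ, X i j ≤ n * m * τ := by
    calc ∑ j ∈ nbr A I, ∑ i ∈ Iᶜ, X i j ≤ ∑ j ∈ nbr A I, ∑ i ∈ Iᶜ, τ :=
          Finset.sum_le_sum fun j hj => Finset.sum_le_sum fun k hk => hsmall j hj k hk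
      _ ≤ ∑ j : Fin m, ∑ i : Fin n, τ := by
          refine (Finset.sum_le_sum_of_subset_of_nonneg (Finset.subset_univ _)
            fun _ _ _ => Finset.sum_nonneg fun _ _ => hτ0.le).trans ?_
          exact Finset.sum_le_sum fun _ _ => Finset.sum_le_sum_of_subset_of_nonneg
            (Finset.subset_univ _) fun _ _ _ => hτ0.le
      _ = n * m * τ := by simp; ring
  have hlt : n * m * τ < η := by
    have : (n * m + 1) * τ = η := by rw [hτ]; field_simp
    linarith
  have h6 := (abs_le.1 (lyap_sub p q X I (nbr A I))).2
  have h7 := hmar I hI hIu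
  rw [hs] at h6
  linarith

theorem epsP_le {n m : ℕ} (A : Matrix (Fin n) (Fin m) ℝ) (hA : ∀ i j, 0 ≤ A i j)
    (I : Finset (Fin n)) (J : Finset (Fin m)) (hI : I.Nonempty) (hI' : I ≠ Finset.univ)
    (j j' : Fin m) (hj : j ∈ J) (hj' : j' ∉ J) :
    epsP A ≤ (∑ i ∈ Iᶜ, A i j / ∑ k, A k j) + ∑ i ∈ I, A i j' / ∑ k, A k j' := by
  have hnn : ∀ (K : Finset (Fin n)) j, 0 ≤ ∑ i ∈ K, A i j / ∑ k, A k j := fun K j =>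
    Finset.sum_nonneg fun i _ => div_nonneg (hA i j) (Finset.sum_nonneg fun k _ => hA k j)
  have hb : ∀ (K : Finset (Fin n)) (S : Set (Fin m)),
      BddBelow ((fun j => ∑ i ∈ K, A i j / ∑ k, A k j) '' S) := by
    intro K S
    refine ⟨0, ?_⟩
    rintro _ ⟨j, _, rfl⟩
    exact hnn K j
  have hb0 : ∀ (K : Finset (Fin n)) (S : Set (Fin m)),
      0 ≤ sInf ((fun j => ∑ i ∈ K, A i j / ∑ k, A k j) '' S) := by
    intro K S
    apply Real.sInf_nonneg
    rintro _ ⟨j, _, rfl⟩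
    exact hnn K j
  have h1 : epsP A ≤ sInf ((fun j => ∑ i ∈ Iᶜ, A i j / ∑ k, A k j) '' (J : Set (Fin m))) +
        sInf ((fun j => ∑ i ∈ I, A i j / ∑ k, A k j) '' ((Jᶜ : Finset (Fin m)) : Set (Fin m))) := by
    apply csInf_le
    · refine ⟨0, ?_⟩
      rintro v ⟨I, J, _, _, _, _, rfl⟩
      exact add_nonneg (hb0 _ _) (hb0 _ _)
    · exact ⟨I, J, hI, hI', ⟨j, hj⟩, fun h => hj' (by rw [h]; simp), rfl⟩
  refine h1.trans (add_le_add ?_ ?_)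
  · exact csInf_le (hb _ _) ⟨j, by simpa using hj, rfl⟩
  · exact csInf_le (hb _ _) ⟨j', by simpa using hj', rfl⟩

/-- any two columns have overlapping support -/
theorem common {n m : ℕ} (A : Matrix (Fin n) (Fin m) ℝ) (hA : ∀ i j, 0 ≤ A i j)
    (hcol : ∀ j, ∃ i, A i j ≠ 0) (heps : 0 < epsP A) (j j' : Fin m) :
    ∃ i, A i j ≠ 0 ∧ A i j' ≠ 0 := by
  classical
  by_cases hjj : j = j'
  · subst hjj
    obtain ⟨i, hi⟩ := hcol j
    exact ⟨i, hi, hi⟩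
  by_contra hcon
  push Not at hcon
  obtain ⟨i, hi⟩ := hcol j
  obtain ⟨i', hi'⟩ := hcol j'
  have h := epsP_le A hA (Finset.univ.filter fun i => A i j ≠ 0) {j} ⟨i, by simpa using hi⟩
    (by
      intro h
      have : i' ∈ (Finset.univ.filter fun i => A i j ≠ 0) := by rw [h]; simp
      simp only [Finset.mem_filter, Finset.mem_univ, true_and] at this
      exact hi' (hcon i' this)) j j' (by simp) (by simpa using Ne.symm hjj)
  rw [Finset.sum_eq_zero, Finset.sum_eq_zero] at h
  · linarith
  · intro k hk
    simp only [Finset.mem_filter, Finset.mem_univ, true_and] at hk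
    rw [hcon k hk]; simp
  · intro k hk
    simp only [Finset.mem_compl, Finset.mem_filter, Finset.mem_univ, true_and, not_not] at hk
    rw [hk]; simp

theorem arith (w ε : ℝ) (hw0 : 0 < w) (hw1 : w < 1) (he : 0 < ε)
    (hw2 : ε < (1 + w) / (1 - w)) (hw3 : 2 * w * (1 + w * rF w ε) ≤ ε) :
    2 * w + 2 * w ^ 2 ≤ ε * (1 - w) := by
  have h1 : 0 < 1 - w := by linarith
  rw [lt_div_iff₀ h1] at hw2
  have hr : 2 ≤ rF w ε * (1 - w) := by
    have e : (1 + ε * w - (1 + ε) * w ^ 2) = (1 - w) * (1 + w + ε * w) := by ring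
    have hd : 0 < (1 + ε * w - (1 + ε) * w ^ 2) := by rw [e]; positivity
    have : rF w ε * (1 - w) = (4 - (1 + ε) * (1 - w) ^ 2) / (1 + ε * w - (1 + ε) * w ^ 2) := by
      unfold rF; field_simp
    rw [this, le_div_iff₀ hd]
    nlinarith [mul_pos hw0 h1, mul_pos he h1, mul_pos (sub_pos.2 hw2) hw0,
      mul_pos (sub_pos.2 hw2) h1]
  have h2 : 2 * w * (1 + w * rF w ε) * (1 - w) ≤ ε * (1 - w) :=
    mul_le_mul_of_nonneg_right hw3 h1.le
  have h3 : 2 * w * (1 + w * rF w ε) * (1 - w) =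
     2 * w * (1 - w) + 2 * w ^ 2 * (rF w ε * (1 - w)) := by ring
  nlinarith [mul_le_mul_of_nonneg_left hr (by positivity : 0 ≤ 2 * w ^ 2)]

theorem margin {n m : ℕ} (A : Matrix (Fin n) (Fin m) ℝ) (p : Fin n → ℝ) (q : Fin m → ℝ)
    (hA : ∀ i j, 0 ≤ A i j)
    (hrow : ∀ i, ∃ j, A i j ≠ 0) (hcol : ∀ j, ∃ i, A i j ≠ 0)
    (hp : ∀ i, 0 < p i) (hbal : ∑ i, p i = ∑ j, q j) (heps : 0 < epsP A)
    (μ : ℝ) (hμ : ∀ i, μ ≤ p i) (hV : lyap p q A < μ)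
    (hε : 2 * lyap p q A < epsP A * (μ - lyap p q A)) :
    ∃ η : ℝ, 0 < η ∧ ∀ I : Finset (Fin n), I.Nonempty → I ≠ Finset.univ →
      ∑ i ∈ I, p i + lyap p q A + η ≤ ∑ j ∈ nbr A I, q j := by
  set V := lyap p q A with hVdef
  refine ⟨min (μ - V) (epsP A * (μ - V) - 2 * V), lt_min (by linarith) (by linarith), ?_⟩
  intro I hI hIu
  by_cases hJ : nbr A I = Finset.univ
  · rw [hJ, ← hbal, ← Finset.sum_add_sum_compl I p]
    obtain ⟨k, hk⟩ : (Iᶜ).Nonempty := by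
      rw [Finset.nonempty_iff_ne_empty]; intro h; exact hIu (by simpa using h)
    have := Finset.single_le_sum (f := p) (fun i _ => (hp i).le) hk
    have := hμ k
    have := min_le_left (μ - V) (epsP A * (μ - V) - 2 * V)
    linarith
  · obtain ⟨j', hj'⟩ : ∃ j', j' ∉ nbr A I := by
      by_contra h; push Not at h; exact hJ (Finset.eq_univ_iff_forall.2 h)
    have hj0 : ∑ i ∈ I, A i j' / ∑ k, A k j' = 0 := by
      apply Finset.sum_eq_zero
      intro i hi
      rw [mem_nbr] at hj'
      push Not at hj'
      rw [hj' i hi]; simp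
    have hc : ∀ j, 0 < ∑ k, A k j := fun j => by
      obtain ⟨i, hi⟩ := hcol j
      exact Finset.sum_pos' (fun i _ => hA i j) ⟨i, by simp, lt_of_le_of_ne (hA i j) (Ne.symm hi)⟩
    have h1 : ∀ j ∈ nbr A I, epsP A * ∑ i, A i j ≤ ∑ i ∈ Iᶜ, A i j := by
      intro j hj
      have := epsP_le A hA I (nbr A I) hI hIu j j' hj hj'
      rw [hj0, add_zero, ← Finset.sum_div, le_div_iff₀ (hc j)] at this
      exact this
    have h2 : epsP A * ∑ j ∈ nbr A I, ∑ i, A i j ≤ ∑ j ∈ nbr A I, ∑ i ∈ Iᶜ, A i j := by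
      rw [Finset.mul_sum]; exact Finset.sum_le_sum h1
    have hs := nbr_split A A I (fun i j h => h)
    have h3 : 0 ≤ ∑ j ∈ nbr A I, ∑ i ∈ Iᶜ, A i j :=
      Finset.sum_nonneg fun _ _ => Finset.sum_nonneg fun _ _ => hA _ _
    have h4 : μ - V ≤ ∑ i ∈ I, ∑ j, A i j := by
      obtain ⟨i, hi⟩ := hI
      have a1 := Finset.single_le_sum (f := fun i => ∑ j, A i j)
        (fun i _ => Finset.sum_nonneg fun j _ => hA i j) hi
      have a2 := (abs_le.1 (lyap_sub p q A {i} ∅)).1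
      simp only [Finset.sum_empty, Finset.sum_singleton] at a1 a2
      have := (abs_le.1 (lyap_sub p q A {i} ∅)).2
      simp only [Finset.sum_empty, Finset.sum_singleton] at this
      have := hμ i
      linarith
    have h5 : epsP A * (μ - V) ≤ epsP A * ∑ j ∈ nbr A I, ∑ i, A i j :=
      mul_le_mul_of_nonneg_left (by linarith) heps.le
    have h6 := (abs_le.1 (lyap_sub p q A I (nbr A I))).1
    have := min_le_right (μ - V) (epsP A * (μ - V) - 2 * V)
    linarith

/-- X is a positive diagonal scaling of A with no larger Lyapunov value. -/
def ScInv {n m : ℕ} (A : Matrix (Fin n) (Fin m) ℝ) (p : Fin n → ℝ) (q : Fin m → ℝ)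
    (X : Matrix (Fin n) (Fin m) ℝ) : Prop :=
  (∃ (x : Fin n → ℝ) (y : Fin m → ℝ), (∀ i, 0 < x i) ∧ (∀ j, 0 < y j) ∧
    X = fun i j => x i * A i j * y j) ∧ lyap p q X ≤ lyap p q A

section
variable {n m : ℕ} {A : Matrix (Fin n) (Fin m) ℝ} {p : Fin n → ℝ} {q : Fin m → ℝ}
  {X : Matrix (Fin n) (Fin m) ℝ}

theorem ScInv.nonneg (h : ScInv A p q X) (hA : ∀ i j, 0 ≤ A i j) : ∀ i j, 0 ≤ X i j := by
  obtain ⟨⟨x, y, hx, hy, rfl⟩, -⟩ := h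
  exact fun i j => mul_nonneg (mul_nonneg (hx i).le (hA i j)) (hy j).le

theorem ScInv.rowpos (h : ScInv A p q X) (hA : ∀ i j, 0 ≤ A i j) (hrow : ∀ i, ∃ j, A i j ≠ 0) :
    ∀ i, 0 < ∑ j, X i j := by
  have h0 := h.nonneg hA
  obtain ⟨⟨x, y, hx, hy, rfl⟩, -⟩ := h
  intro i
  obtain ⟨j, hj⟩ := hrow i
  exact Finset.sum_pos' (fun j _ => h0 i j)
    ⟨j, by simp, mul_pos (mul_pos (hx i) (lt_of_le_of_ne (hA i j) (Ne.symm hj))) (hy j)⟩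

theorem ScInv.colpos (h : ScInv A p q X) (hA : ∀ i j, 0 ≤ A i j) (hcol : ∀ j, ∃ i, A i j ≠ 0) :
    ∀ j, 0 < ∑ i, X i j := by
  have h0 := h.nonneg hA
  obtain ⟨⟨x, y, hx, hy, rfl⟩, -⟩ := h
  intro j
  obtain ⟨i, hi⟩ := hcol j
  exact Finset.sum_pos' (fun i _ => h0 i j)
    ⟨i, by simp, mul_pos (mul_pos (hx i) (lt_of_le_of_ne (hA i j) (Ne.symm hi))) (hy j)⟩

theorem ScInv.row (h : ScInv A p q X) (hA : ∀ i j, 0 ≤ A i j) (hrow : ∀ i, ∃ j, A i j ≠ 0)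
    (hp : ∀ i, 0 < p i) : ScInv A p q (rowBal p X) := by
  have h0 := h.nonneg hA
  have h1 := h.rowpos hA hrow
  refine ⟨?_, (rowBal_mono p q X h0 h1).trans h.2⟩
  obtain ⟨⟨x, y, hx, hy, hX⟩, -⟩ := h
  refine ⟨fun i => p i / (∑ l, X i l) * x i, y,
    fun i => mul_pos (div_pos (hp i) (h1 i)) (hx i), hy, ?_⟩
  funext i j
  have : X i j = x i * A i j * y j := by rw [hX]
  simp only [rowBal]
  rw [this]; ring

theorem ScInv.col (h : ScInv A p q X) (hA : ∀ i j, 0 ≤ A i j) (hcol : ∀ j, ∃ i, A i j ≠ 0)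
    (hq : ∀ j, 0 < q j) : ScInv A p q (colBal q X) := by
  have h0 := h.nonneg hA
  have h1 := h.colpos hA hcol
  refine ⟨?_, (colBal_mono p q X h0 h1).trans h.2⟩
  obtain ⟨⟨x, y, hx, hy, hX⟩, -⟩ := h
  refine ⟨x, fun j => q j / (∑ l, X l j) * y j, hx,
    fun i => mul_pos (div_pos (hq i) (h1 i)) (hy i), ?_⟩
  funext i j
  have : X i j = x i * A i j * y j := by rw [hX]
  simp only [colBal]
  rw [this]; ring

theorem ScInv.iter (hA : ∀ i j, 0 ≤ A i j) (hrow : ∀ i, ∃ j, A i j ≠ 0)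
    (hcol : ∀ j, ∃ i, A i j ≠ 0) (hp : ∀ i, 0 < p i) (hq : ∀ j, 0 < q j) (s : ℕ) :
    ScInv A p q (iterBal p q A s) := by
  induction s with
  | zero => exact ⟨⟨fun _ => 1, fun _ => 1, by simp, by simp, by simp [iterBal]⟩, le_rfl⟩
  | succ s ih =>
    rw [iterBal]
    split_ifs
    · exact ih.row hA hrow hp
    · exact ih.col hA hcol hq

theorem col_contract (hm : 2 ≤ m) (hbal : ∑ i, p i = ∑ j, q j)
    (h0 : ∀ i j, 0 ≤ X i j) (hr : ∀ i, ∑ j, X i j = p i) (hc : ∀ j, 0 < ∑ i, X i j) (d : ℝ)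
    (hd : ∀ j j', ∃ i, d ≤ X i j / (∑ k, X k j) ∧ d ≤ X i j' / (∑ k, X k j')) :
    lyap p q (colBal q X) ≤ (1 - d) * lyap p q X := by
  have h := dob (fun i j => X i j / ∑ k, X k j) (fun j => q j - ∑ k, X k j) d hm
    (fun i j => div_nonneg (h0 i j) (hc j).le)
    (fun j => by rw [← Finset.sum_div, div_self (hc j).ne']) hd
    (by
      rw [Finset.sum_sub_distrib, Finset.sum_comm, ← hbal]
      simp [hr])
  have e1 : lyap p q X = ∑ j, |q j - ∑ k, X k j| := by
    simp only [lyap, hr, sub_self, abs_zero, Finset.sum_const_zero, zero_add]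
    exact Finset.sum_congr rfl fun j _ => abs_sub_comm _ _
  have e2 : lyap p q (colBal q X) =
      ∑ i, |∑ j, X i j / (∑ k, X k j) * (q j - ∑ k, X k j)| := by
    have a1 : ∀ j, ∑ i, colBal q X i j = q j := by
      intro j
      simp only [colBal]
      rw [← Finset.sum_div, ← Finset.mul_sum]
      exact mul_div_cancel_right₀ _ (hc j).ne'
    simp only [lyap, a1, sub_self, abs_zero, Finset.sum_const_zero, add_zero]
    refine Finset.sum_congr rfl fun i _ => ?_
    rw [← hr i, ← Finset.sum_sub_distrib]
    congr 1
    refine Finset.sum_congr rfl fun j _ => ?_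
    have := (hc j).ne'
    simp only [colBal]
    field_simp
  rw [e1, e2]; exact h

end

/-- Theorem 1: convergence of the alternating balancing procedure to the admissible set
with the speed of a geometric progression. -/
theorem balancing_converges_geometrically
    {n m : ℕ} (hn : 2 ≤ n) (hm : 2 ≤ m)
    (A : Matrix (Fin n) (Fin m) ℝ) (p : Fin n → ℝ) (q : Fin m → ℝ)
    (hA : ∀ i j, 0 ≤ A i j)
    (hrow : ∀ i, ∃ j, A i j ≠ 0)
    (hcol : ∀ j, ∃ i, A i j ≠ 0)
    (hp : ∀ i, 0 < p i) (hq : ∀ j, 0 < q j)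
    (hbal : ∑ i, p i = ∑ j, q j)
    (heps : 0 < epsP A)
    (hw1 : lyap p q A / (⨅ i, p i) < 1)
    (hw2 : epsP A < (1 + lyap p q A / (⨅ i, p i)) / (1 - lyap p q A / (⨅ i, p i)))
    (hw3 : 2 * (lyap p q A / (⨅ i, p i)) *
        (1 + (lyap p q A / (⨅ i, p i)) * rF (lyap p q A / (⨅ i, p i)) (epsP A)) ≤ epsP A) :
    (∀ s, (∀ i, 0 < ∑ j, iterBal p q A s i j) ∧ (∀ j, 0 < ∑ i, iterBal p q A s i j)) ∧
    ∃ α : ℝ, 0 < α ∧ α < 1 ∧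
      ∀ t : ℕ, lyap p q (iterBal p q A (2 * t)) ≤ (1 - α) ^ t * lyap p q A := by
  have hinv := fun s => ScInv.iter (p := p) (q := q) hA hrow hcol hp hq s
  refine ⟨fun s => ⟨(hinv s).rowpos hA hrow, (hinv s).colpos hA hcol⟩, ?_⟩
  have hV0 : 0 ≤ lyap p q A :=
    add_nonneg (Finset.sum_nonneg fun _ _ => abs_nonneg _)
      (Finset.sum_nonneg fun _ _ => abs_nonneg _)
  rcases hV0.eq_or_lt with hV | hV
  · refine ⟨1 / 2, by norm_num, by norm_num, fun t => ?_⟩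
    have := (hinv (2 * t)).2
    rw [← hV] at this ⊢
    simpa using this
  have : Nonempty (Fin n) := ⟨⟨0, by omega⟩⟩
  have : Nonempty (Fin m) := ⟨⟨0, by omega⟩⟩
  set μ := ⨅ i, p i with hμdef
  have hμ : ∀ i, μ ≤ p i := fun i => ciInf_le (Set.finite_range p).bddBelow i
  have hμ0 : 0 < μ := by
    obtain ⟨i, hi⟩ := exists_eq_ciInf_of_finite (f := p)
    rw [hμdef, ← hi]; exact hp i
  have hε := arith _ _ (div_pos hV hμ0) hw1 heps hw2 hw3
  have hwμ : lyap p q A / μ * μ = lyap p q A := div_mul_cancel₀ _ hμ0.ne'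
  rw [div_lt_one hμ0] at hw1
  have hε' : 2 * lyap p q A < epsP A * (μ - lyap p q A) := by
    have h1 : 0 < 2 * (lyap p q A / μ) ^ 2 * μ := by
      have := div_pos hV hμ0
      positivity
    have h2 := mul_le_mul_of_nonneg_right hε hμ0.le
    have h3 : epsP A * (1 - lyap p q A / μ) * μ = epsP A * (μ - lyap p q A / μ * μ) := by ring
    rw [h3, hwμ] at h2
    have h4 : (2 * (lyap p q A / μ) + 2 * (lyap p q A / μ) ^ 2) * μ =
      2 * (lyap p q A / μ * μ) + 2 * (lyap p q A / μ) ^ 2 * μ := by ring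
    rw [h4, hwμ] at h2
    linarith
  obtain ⟨η, hη, hmar⟩ := margin A p q hA hrow hcol hp hbal heps μ hμ hw1 hε'
  obtain ⟨a, ha, haA⟩ : ∃ a : ℝ, 0 < a ∧ ∀ i j, A i j ≠ 0 → a ≤ A i j := by
    obtain ⟨z, hz⟩ := Finite.exists_min
      (fun z : Fin n × Fin m => if A z.1 z.2 = 0 then (1 : ℝ) else A z.1 z.2)
    refine ⟨_, ?_, fun i j hij => (hz (i, j)).trans (by simp [hij])⟩
    split_ifs with h
    · norm_num
    · exact lt_of_le_of_ne (hA _ _) (Ne.symm h)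
  set M := (∑ i, ∑ j, A i j) + 1 with hM
  have hM0 : 0 < M := by
    have : 0 ≤ ∑ i, ∑ j, A i j := Finset.sum_nonneg fun _ _ => Finset.sum_nonneg fun _ _ => hA _ _
    linarith
  have hcM : ∀ j, ∑ i, A i j ≤ M := by
    intro j
    have : ∑ i, A i j ≤ ∑ i, ∑ j, A i j := Finset.sum_le_sum fun i _ =>
      Finset.single_le_sum (f := fun j => A i j) (fun j _ => hA i j) (Finset.mem_univ j)
    linarith
  have hAM : ∀ i j, A i j ≤ M := fun i j =>
    (Finset.single_le_sum (f := fun i => A i j) (fun i _ => hA i j) (Finset.mem_univ i)).trans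
      (hcM j)
  obtain ⟨R, hR1, hR⟩ := gap A p q _ η hη hV0 hA hq hmar a M ha hM0 haA hAM
  set d := min (1 / 2) (a / (R * M)) with hd
  have hd0 : 0 < d := lt_min (by norm_num) (by positivity)
  have hd1 : d ≤ 1 / 2 := min_le_left _ _
  have hstep : ∀ X, ScInv A p q X → lyap p q (colBal q (rowBal p X)) ≤ (1 - d) * lyap p q X := by
    intro X hX
    have hrp := hX.rowpos hA hrow
    have hY := hX.row hA hrow hp
    have hm1 := rowBal_mono p q X (hX.nonneg hA) hrp
    refine (col_contract hm hbal (hY.nonneg hA) (rowBal_row p X hrp) (hY.colpos hA hcol) d ?_).trans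
      (mul_le_mul_of_nonneg_left hm1 (by linarith))
    have hcp := hY.colpos hA hcol
    obtain ⟨⟨x, y, hx, hy, hXY⟩, hle⟩ := hY
    rw [hXY] at hle hcp ⊢
    have hrat := hR x y hx hy hle
    have key : ∀ i j, A i j ≠ 0 → d ≤ x i * A i j * y j / ∑ k, x k * A k j * y j := by
      intro i j hij
      refine (min_le_right _ _).trans ?_
      rw [div_le_div_iff₀ (by positivity) (hcp j)]
      have h1 : ∑ k, x k * A k j * y j ≤ R * x i * y j * ∑ k, A k j := by
        rw [Finset.mul_sum]
        apply Finset.sum_le_sum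
        intro k _
        have : x k * (A k j * y j) ≤ R * x i * (A k j * y j) :=
          mul_le_mul_of_nonneg_right (hrat k i) (mul_nonneg (hA k j) (hy j).le)
        linarith
      have hxi := hx i
      have hyj := hy j
      have h2 : R * x i * y j * ∑ k, A k j ≤ R * x i * y j * M :=
        mul_le_mul_of_nonneg_left (hcM j) (by positivity)
      calc a * ∑ k, x k * A k j * y j ≤ a * (R * x i * y j * M) :=
            mul_le_mul_of_nonneg_left (h1.trans h2) ha.le
        _ ≤ A i j * (R * x i * y j * M) :=
            mul_le_mul_of_nonneg_right (haA i j hij) (by positivity)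
        _ = _ := by ring
    intro j j'
    obtain ⟨i, h1, h2⟩ := common A hA hcol heps j j'
    exact ⟨i, key i j h1, key i j' h2⟩
  refine ⟨d, hd0, by linarith, fun t => ?_⟩
  induction t with
  | zero => simp [iterBal]
  | succ t ih =>
    have e : iterBal p q A (2 * (t + 1)) = colBal q (rowBal p (iterBal p q A (2 * t))) := by
      rw [show 2 * (t + 1) = 2 * t + 1 + 1 by ring, iterBal, iterBal]
      rw [if_neg (by omega), if_pos (by omega)]
    rw [e, pow_succ]
    refine (hstep _ (hinv _)).trans ?_
    have := mul_le_mul_of_nonneg_left ih (by linarith : 0 ≤ 1 - d)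
    linarith
end

section
/- Let ε₁, ε₂ > 0 and V₀ > 0 satisfy 0 < ε₂V₀ < 1, 0 < ε₁ < (1 + ε₂V₀)/(1 − ε₂V₀), and 2ε₂V₀(1 + ε₂V₀·r(ε₂V₀, ε₁)) ≤ ε₁. Define the sequence (V_i)_{i≥0} recursively by V_i = (1 − ε₁ ∏_{j=0}^{i−1} (1 − ε₂V_j)/(1 + ε₂V_j)) · V_{i−1} for i ≥ 1, and set α = 2ε₁ε₂V₀(1 + (1+ε₁)ε₂V₀)·((1 − ε₂V₀)/(1 + ε₂V₀))². Then 0 < α < 1 and for every i ≥ 0 one has 0 < V_i ≤ (1−α)^i · V₀; that is, (V_i) is majorized by a geometric progression with initial term V₀ and ratio 1−α ∈ (0,1). -/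
open Finset

/-- Lemma 1: the recursively defined sequence `V_i = (1 − ε₁ ∏_{j<i} (1−ε₂V_j)/(1+ε₂V_j)) V_{i−1}`
is majorized by a geometric progression with initial term `V₀` and ratio `1 − α ∈ (0,1)`,
where `α = 2ε₁ε₂V₀(1 + (1+ε₁)ε₂V₀)((1−ε₂V₀)/(1+ε₂V₀))²`. -/
theorem recursive_sequence_majorized_by_geometric
    (ε₁ ε₂ : ℝ) (V : ℕ → ℝ)
    (hε₁ : 0 < ε₁) (hε₂ : 0 < ε₂) (hV0 : 0 < V 0)
    (h1 : ε₂ * V 0 < 1)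
    (h2 : ε₁ < (1 + ε₂ * V 0) / (1 - ε₂ * V 0))
    (h3 : 2 * (ε₂ * V 0) * (1 + ε₂ * V 0 * rF (ε₂ * V 0) ε₁) ≤ ε₁)
    (hrec : ∀ i : ℕ, V (i + 1) =
      (1 - ε₁ * ∏ j ∈ Finset.range (i + 1), (1 - ε₂ * V j) / (1 + ε₂ * V j)) * V i) :
    ∃ α : ℝ,
      α = 2 * ε₁ * ε₂ * V 0 * (1 + (1 + ε₁) * ε₂ * V 0) *
            ((1 - ε₂ * V 0) / (1 + ε₂ * V 0)) ^ 2 ∧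
      0 < α ∧ α < 1 ∧ ∀ i : ℕ, 0 < V i ∧ V i ≤ (1 - α) ^ i * V 0 := by
  obtain ⟨w, hw⟩ : ∃ w : ℕ → ℝ, ∀ i, w i = ε₂ * V i := ⟨fun i => ε₂ * V i, fun _ => rfl⟩
  obtain ⟨P, hP⟩ : ∃ P : ℕ → ℝ, ∀ i, P i = ∏ j ∈ Finset.range (i + 1),
    (1 - w j) / (1 + w j) := ⟨_, fun _ => rfl⟩
  have hrec' : ∀ i, V (i + 1) = (1 - ε₁ * P i) * V i := by
    intro i
    rw [hrec i, hP]
    simp only [hw]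
  have hw0 : 0 < w 0 := by rw [hw]; positivity
  rw [← hw] at h1 h2 h3
  have hq0 : P 0 = (1 - w 0) / (1 + w 0) := by simp [hP]
  have hPs : ∀ i, P (i + 1) = P i * ((1 - w (i + 1)) / (1 + w (i + 1))) := by
    intro i
    rw [hP, Finset.prod_range_succ, ← hP]
  have hwr : ∀ i, w (i + 1) = (1 - ε₁ * P i) * w i := by
    intro i
    rw [hw, hw, hrec']; ring
  have hqpos : 0 < P 0 := by rw [hq0]; exact div_pos (by linarith) (by linarith)
  have hqe : P 0 * (1 + w 0) = 1 - w 0 := by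
    rw [hq0]; field_simp
  have h2' : ε₁ * (1 - w 0) < 1 + w 0 := by
    rwa [lt_div_iff₀ (by linarith)] at h2
  have heq : ε₁ * P 0 < 1 := by
    rw [hq0, ← mul_div_assoc, div_lt_one (by linarith)]; exact h2'
  have basic : ∀ i, 0 < V i ∧ 0 < w i ∧ w i ≤ w 0 ∧ 0 < P i ∧ P i ≤ P 0 := by
    intro i
    induction i with
    | zero => exact ⟨hV0, hw0, le_rfl, hqpos, le_rfl⟩
    | succ n ih =>
      obtain ⟨a, b, c, d, f⟩ := ih
      have g : ε₁ * P n ≤ ε₁ * P 0 := mul_le_mul_of_nonneg_left f hε₁.le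
      have g0 : 0 < ε₁ * P n := mul_pos hε₁ d
      have k : 0 < w (n + 1) := by rw [hwr]; exact mul_pos (by linarith) b
      have k' : w (n + 1) ≤ w 0 := by rw [hwr]; nlinarith
      have l : 0 < (1 - w (n + 1)) / (1 + w (n + 1)) := div_pos (by linarith) (by linarith)
      have l' : (1 - w (n + 1)) / (1 + w (n + 1)) ≤ 1 := by
        rw [div_le_one (by linarith)]; linarith
      refine ⟨by rw [hrec']; exact mul_pos (by linarith) a, k, k', ?_, ?_⟩
      · rw [hPs]; exact mul_pos d l
      · rw [hPs]; nlinarith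
  have dec : ∀ i, w (i + 1) ≤ w i := by
    intro i
    obtain ⟨a, b, c, d, f⟩ := basic i
    have := mul_pos (mul_pos hε₁ d) b
    rw [hwr]; linarith
  have inv : ∀ n, w (n + 1) ≤ w 1 ∧
      ε₁ * (1 - w 1) * P 0 - 2 * (w 1 - w (n + 1)) ≤ ε₁ * (1 - w 1) * P n := by
    intro n
    induction n with
    | zero => exact ⟨le_rfl, by simp⟩
    | succ n ih =>
      obtain ⟨i1, i2⟩ := ih
      obtain ⟨a, b, c, d, f⟩ := basic (n + 1)
      obtain ⟨_, _, _, d', _⟩ := basic n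
      refine ⟨(dec (n + 1)).trans i1, ?_⟩
      have s : P (n + 1) * (1 + w (n + 1)) = P n * (1 - w (n + 1)) := by
        rw [hPs]; field_simp
      have t := hwr (n + 1)
      have u : (1 - w 1) * (P n + P (n + 1)) ≤ 2 * P (n + 1) := by
        have : (1 - w 1) * (P n + P (n + 1)) ≤ (1 - w (n + 1)) * (P n + P (n + 1)) :=
          mul_le_mul_of_nonneg_right (by linarith) (by linarith)
        linarith
      have v := mul_le_mul_of_nonneg_left u (mul_pos hε₁ b).le
      have s' : P n - P (n + 1) = w (n + 1) * (P n + P (n + 1)) := by linarith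
      have s2 : ε₁ * (1 - w 1) * (P n - P (n + 1)) =
        ε₁ * w (n + 1) * ((1 - w 1) * (P n + P (n + 1))) := by rw [s']; ring
      linarith
  -- the hypothesis `h3` in polynomial form
  have hD : 0 < (1 - w 0) * (1 + (1 + ε₁) * w 0) := mul_pos (by linarith) (by positivity)
  have h3' : 2 * w 0 * (1 + w 0) ^ 2 ≤
      ε₁ * (1 - w 0) * ((1 - w 0) * (1 + (1 + ε₁) * w 0)) := by
    have hr : rF (w 0) ε₁ * (((1 - w 0) * (1 + (1 + ε₁) * w 0)) * (1 - w 0)) =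
        4 - (1 + ε₁) * (1 - w 0) ^ 2 := by
      have : (1 + ε₁ * w 0 - (1 + ε₁) * w 0 ^ 2) = (1 - w 0) * (1 + (1 + ε₁) * w 0) := by ring
      rw [rF, this]
      exact div_mul_cancel₀ _ (mul_pos hD (by linarith)).ne'
    have := mul_le_mul_of_nonneg_right h3 (mul_pos hD (by linarith : 0 < 1 - w 0)).le
    linear_combination this - 2 * w 0 ^ 2 * hr
  have key : ∀ n, 2 * w 0 * (1 + (1 + ε₁) * w 0) * P 0 ^ 2 ≤ P n := by
    intro n
    obtain ⟨_, i2⟩ := inv n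
    obtain ⟨_, b, _⟩ := basic (n + 1)
    have hw1 : w 1 = (1 - ε₁ * P 0) * w 0 := hwr 0
    have a1 : (1 - w 1) * (1 + w 0) = (1 - w 0) * (1 + (1 + ε₁) * w 0) := by
      rw [hw1]; linear_combination (ε₁ * w 0) * hqe
    have ha : 0 < 1 - w 1 := by linarith [dec 0]
    have i3 : ε₁ * (1 - w 1) * P 0 - 2 * w 1 ≤ ε₁ * (1 - w 1) * P n := by linarith
    refine le_of_mul_le_mul_left (le_trans ?_ i3) (mul_pos hε₁ ha)
    have hle : (1 - w 1) ≤ 1 := by linarith [(basic 1).2.1]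
    -- `h3'` divided by `(1 + w 0) ^ 2`
    have c1 : 2 * w 0 ≤ ε₁ * P 0 * (1 - w 1) := by
      have : 0 < (1 + w 0) ^ 2 := by positivity
      refine le_of_mul_le_mul_right (h3'.trans (le_of_eq ?_)) this
      rw [← a1]
      linear_combination (-ε₁ * (1 - w 1) * (1 + w 0)) * hqe
    have c2 : (1 + (1 + ε₁) * w 0) * P 0 = 1 - w 1 := by
      have : (0:ℝ) < 1 + w 0 := by positivity
      refine mul_right_cancel₀ this.ne' ?_
      rw [a1]; linear_combination (1 + (1 + ε₁) * w 0) * hqe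
    have c3 : ε₁ * (1 - w 1) * (2 * w 0 * (1 + (1 + ε₁) * w 0) * P 0 ^ 2) =
      2 * w 0 * ε₁ * P 0 * (1 - w 1) ^ 2 := by
      linear_combination (ε₁ * (1 - w 1) * 2 * w 0 * P 0) * c2
    have c4 : (1 - w 1) ^ 2 ≤ 1 := by nlinarith
    have c5 := mul_le_mul_of_nonneg_left c4 (by positivity : 0 ≤ 2 * w 0 * ε₁ * P 0)
    rw [c3]
    nlinarith
  have hα : 2 * ε₁ * ε₂ * V 0 * (1 + (1 + ε₁) * ε₂ * V 0) *
            ((1 - ε₂ * V 0) / (1 + ε₂ * V 0)) ^ 2 =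
      ε₁ * (2 * w 0 * (1 + (1 + ε₁) * w 0) * P 0 ^ 2) := by
    rw [hq0, hw]; ring
  have hle : ∀ n, ε₁ * (2 * w 0 * (1 + (1 + ε₁) * w 0) * P 0 ^ 2) ≤ ε₁ * P n :=
    fun n => mul_le_mul_of_nonneg_left (key n) hε₁.le
  refine ⟨_, rfl, ?_, ?_, ?_⟩
  · rw [hα]; positivity
  · rw [hα]; linarith [hle 0]
  · rw [hα]
    intro i
    refine ⟨(basic i).1, ?_⟩
    induction i with
    | zero => simp
    | succ n ih =>
      rw [hrec', pow_succ]
      have x := mul_le_mul_of_nonneg_right (hle n) (basic n).1.le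
      have y := mul_le_mul_of_nonneg_left ih
        (by linarith [hle 0] : 0 ≤ 1 - ε₁ * (2 * w 0 * (1 + (1 + ε₁) * w 0) * P 0 ^ 2))
      linarith
end

section
/- Let X ∈ ℝ^{n×m} have nonnegative entries and strictly positive row sums, and let p ∈ ℝ^n, q ∈ ℝ^m. Define X' by X'_{ij} = p_i x_{ij}/(∑_{l=1}^m x_{il}). Then V(X') ≤ V(X). -/
open Finset

/-- The row-balancing step does not increase the Lyapunov function. -/
theorem rowBal_lyap_nonincreasing
    {n m : ℕ} (X : Matrix (Fin n) (Fin m) ℝ) (p : Fin n → ℝ) (q : Fin m → ℝ)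
    (hX : ∀ i j, 0 ≤ X i j) (hrs : ∀ i, 0 < ∑ l, X i l) :
    lyap p q (rowBal p X) ≤ lyap p q X := by
  have h1 : ∀ i, (∑ j, rowBal p X i j) - p i = 0 := by
    intro i
    have h := (hrs i).ne'
    simp only [rowBal]
    rw [← Finset.sum_div, ← Finset.mul_sum, mul_div_assoc, div_self h]
    ring
  have h2 : ∀ i, ∑ j, |rowBal p X i j - X i j| = |(∑ j, X i j) - p i| := by
    intro i
    have h := hrs i
    have h3 : ∀ j, |rowBal p X i j - X i j| = |(∑ j, X i j) - p i| / (∑ l, X i l) * X i j := by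
      intro j
      have e : rowBal p X i j - X i j = -(((∑ l, X i l) - p i) / (∑ l, X i l) * X i j) := by
        simp only [rowBal]
        field_simp
        ring
      rw [e, abs_neg, abs_mul, abs_div, abs_of_pos h, abs_of_nonneg (hX i j)]
    rw [Finset.sum_congr rfl (fun j _ => h3 j), ← Finset.mul_sum, div_mul_cancel₀ _ h.ne']
  have h4 : ∀ j, |(∑ i, rowBal p X i j) - q j| ≤
      (∑ i, |rowBal p X i j - X i j|) + |(∑ i, X i j) - q j| := by
    intro j
    have e : (∑ i, rowBal p X i j) - q j =
        (∑ i, (rowBal p X i j - X i j)) + ((∑ i, X i j) - q j) := by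
      rw [Finset.sum_sub_distrib]
      ring
    rw [e]
    exact (abs_add_le _ _).trans (add_le_add (Finset.abs_sum_le_sum_abs _ _) le_rfl)
  unfold lyap
  simp only [h1, abs_zero, Finset.sum_const_zero, zero_add]
  refine (Finset.sum_le_sum (fun j _ => h4 j)).trans ?_
  rw [Finset.sum_add_distrib, Finset.sum_comm, Finset.sum_congr rfl (fun i _ => h2 i)]
end

section
/- Let X ∈ ℝ^{n×m} have nonnegative entries and strictly positive column sums, and let p ∈ ℝ^n, q ∈ ℝ^m. Define X'' by X''_{ij} = q_j x_{ij}/(∑_{k=1}^n x_{kj}). Then V(X'') ≤ V(X). -/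
open Finset

/-- The column-balancing step does not increase the Lyapunov function. -/
theorem colBal_lyap_nonincreasing
    {n m : ℕ} (X : Matrix (Fin n) (Fin m) ℝ) (p : Fin n → ℝ) (q : Fin m → ℝ)
    (hX : ∀ i j, 0 ≤ X i j) (hcs : ∀ j, 0 < ∑ k, X k j) :
    lyap p q (colBal q X) ≤ lyap p q X := by
  have hcol : ∀ j, (∑ i, colBal q X i j) - q j = 0 := by
    intro j
    have h := (hcs j).ne'
    simp only [colBal]
    rw [← Finset.sum_div, ← Finset.mul_sum, mul_div_assoc, div_self h]
    ring
  have hdiff : ∀ j, ∑ i, |colBal q X i j - X i j| = |(∑ i, X i j) - q j| := by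
    intro j
    have h := hcs j
    have h1 : ∀ i, |colBal q X i j - X i j|
        = X i j * (|(∑ k, X k j) - q j| / ∑ k, X k j) := by
      intro i
      have e : colBal q X i j - X i j
          = -(X i j * (((∑ k, X k j) - q j) / ∑ k, X k j)) := by
        simp only [colBal]
        field_simp
        ring
      rw [e, abs_neg, abs_mul, abs_div, abs_of_nonneg (hX i j), abs_of_pos h]
    rw [Finset.sum_congr rfl fun i _ => h1 i, ← Finset.sum_mul]
    field_simp
  have hrow : ∀ i, |(∑ j, colBal q X i j) - p i|
      ≤ |(∑ j, X i j) - p i| + ∑ j, |colBal q X i j - X i j| := by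
    intro i
    have e : (∑ j, colBal q X i j) - p i
        = ((∑ j, X i j) - p i) + ∑ j, (colBal q X i j - X i j) := by
      rw [Finset.sum_sub_distrib]
      ring
    rw [e]
    exact (abs_add_le _ _).trans (by gcongr; exact Finset.abs_sum_le_sum_abs _ _)
  unfold lyap
  simp only [hcol, abs_zero, Finset.sum_const_zero, add_zero]
  refine (Finset.sum_le_sum fun i _ => hrow i).trans ?_
  rw [Finset.sum_add_distrib, Finset.sum_comm, Finset.sum_congr rfl fun j _ => hdiff j]
end

section
/- Let X ∈ ℝ^{n×m} have nonnegative entries with no zero row and no zero column, and let p ∈ ℝ^n have strictly positive entries and q ∈ ℝ^m. Let X' be the row-balancing step applied to X, i.e. X'_{ij} = p_i x_{ij}/(∑_{l=1}^m x_{il}), and let X'' be the column-balancing step applied to X', i.e. X''_{ij} = q_j X'_{ij}/(∑_{k=1}^n X'_{kj}) (the column sums of X' are positive, so X'' is well defined). Then ‖X'' − X‖₁ ≤ 2·V(X). -/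
open Finset

theorem aux_scale {k : ℕ} (x : Fin k → ℝ) (t : ℝ) (hx : ∀ i, 0 ≤ x i) (hs : 0 < ∑ i, x i) :
    ∑ i, |t * x i / (∑ l, x l) - x i| = |(∑ i, x i) - t| := by
  have h : ∀ i, |t * x i / (∑ l, x l) - x i| = x i * (|(∑ l, x l) - t| / (∑ l, x l)) := by
    intro i
    have e : t * x i / (∑ l, x l) - x i = x i * ((t - ∑ l, x l) / (∑ l, x l)) := by
      field_simp
    rw [e, abs_mul, abs_div, abs_of_nonneg (hx i), abs_of_pos hs, abs_sub_comm]
  rw [Finset.sum_congr rfl (fun i _ => h i), ← Finset.sum_mul]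
  field_simp

theorem aux_pos {k : ℕ} (x : Fin k → ℝ) (hx : ∀ i, 0 ≤ x i) (h : ∃ i, x i ≠ 0) :
    0 < ∑ i, x i := by
  obtain ⟨i, hi⟩ := h
  exact Finset.sum_pos' (fun i _ => hx i) ⟨i, Finset.mem_univ i, lt_of_le_of_ne (hx i) hi.symm⟩

/-- One full iteration (row-balancing then column-balancing) moves the matrix by at most
twice the Lyapunov function in the entrywise 1-norm. -/
theorem full_iteration_norm1_bound
    {n m : ℕ} (X : Matrix (Fin n) (Fin m) ℝ) (p : Fin n → ℝ) (q : Fin m → ℝ)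
    (hX : ∀ i j, 0 ≤ X i j)
    (hrow : ∀ i, ∃ j, X i j ≠ 0)
    (hcol : ∀ j, ∃ i, X i j ≠ 0)
    (hp : ∀ i, 0 < p i) :
    norm1 (colBal q (rowBal p X) - X) ≤ 2 * lyap p q X := by
  have hr : ∀ i, 0 < ∑ j, X i j := fun i => aux_pos (X i) (hX i) (hrow i)
  set Y := rowBal p X with hY
  have hY0 : ∀ i j, 0 ≤ Y i j := fun i j =>
    div_nonneg (mul_nonneg (hp i).le (hX i j)) (hr i).le
  have hc : ∀ j, 0 < ∑ i, Y i j := fun j => by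
    refine aux_pos (fun i => Y i j) (fun i => hY0 i j) ?_
    obtain ⟨i, hi⟩ := hcol j
    exact ⟨i, div_ne_zero (mul_ne_zero (hp i).ne' hi) (hr i).ne'⟩
  have h1 : ∑ i, ∑ j, |Y i j - X i j| = ∑ i, |(∑ j, X i j) - p i| :=
    Finset.sum_congr rfl (fun i _ => aux_scale (X i) (p i) (hX i) (hr i))
  have h2 : ∑ i, ∑ j, |colBal q Y i j - Y i j| = ∑ j, |(∑ i, Y i j) - q j| := by
    rw [Finset.sum_comm]
    exact Finset.sum_congr rfl
      (fun j _ => aux_scale (fun i => Y i j) (q j) (fun i => hY0 i j) (hc j))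
  have h3 : ∑ j, |(∑ i, Y i j) - q j| ≤
      ∑ i, ∑ j, |Y i j - X i j| + ∑ j, |(∑ i, X i j) - q j| := by
    rw [Finset.sum_comm, ← Finset.sum_add_distrib]
    refine Finset.sum_le_sum (fun j _ => ?_)
    have h5 := abs_sub_le (∑ i, Y i j) (∑ i, X i j) (q j)
    have h6 : |(∑ i, Y i j) - ∑ i, X i j| ≤ ∑ i, |Y i j - X i j| := by
      rw [← Finset.sum_sub_distrib]
      exact Finset.abs_sum_le_sum_abs _ _
    linarith
  have h4 : norm1 (colBal q Y - X) ≤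
      ∑ i, ∑ j, |colBal q Y i j - Y i j| + ∑ i, ∑ j, |Y i j - X i j| := by
    unfold norm1
    simp only [← Finset.sum_add_distrib]
    exact Finset.sum_le_sum (fun i _ => Finset.sum_le_sum (fun j _ => abs_sub_le _ _ _))
  have h7 : 0 ≤ ∑ j, |(∑ i, X i j) - q j| := Finset.sum_nonneg (fun j _ => abs_nonneg _)
  unfold lyap
  linarith
end

section
/- Let X ∈ ℝ^{n×m} have nonnegative entries and strictly positive column sums, and let q ∈ ℝ^m. Define X'' by X''_{ij} = q_j x_{ij}/(∑_{k=1}^n x_{kj}). Then ‖X'' − X‖₁ = ∑_{j=1}^m |∑_{i=1}^n x_{ij} − q_j|. -/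
open Finset

/-- The 1-norm displacement of the column-balancing step equals the column-sum residual. -/
theorem colBal_norm1_displacement
    {n m : ℕ} (X : Matrix (Fin n) (Fin m) ℝ) (q : Fin m → ℝ)
    (hX : ∀ i j, 0 ≤ X i j) (hcs : ∀ j, 0 < ∑ k, X k j) :
    norm1 (colBal q X - X) = ∑ j, |(∑ i, X i j) - q j| := by
  unfold norm1
  rw [Finset.sum_comm]
  refine Finset.sum_congr rfl fun j _ => ?_
  have hs := hcs j
  have key : ∀ i, |(colBal q X - X) i j| = X i j * (|(∑ k, X k j) - q j| / ∑ k, X k j) := by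
    intro i
    have e : (colBal q X - X) i j = -(X i j * (((∑ k, X k j) - q j) / ∑ k, X k j)) := by
      rw [Matrix.sub_apply]
      unfold colBal
      field_simp
      ring
    rw [e, abs_neg, abs_mul, abs_div, abs_of_nonneg (hX i j), abs_of_pos hs]
  rw [Finset.sum_congr rfl fun i _ => key i, ← Finset.sum_mul]
  field_simp
end

section
/- Let X ∈ ℝ^{n×m} have nonnegative entries and strictly positive row sums, and let p ∈ ℝ^n. Define X' by X'_{ij} = p_i x_{ij}/(∑_{l=1}^m x_{il}). Then ‖X' − X‖₁ = ∑_{i=1}^n |∑_{j=1}^m x_{ij} − p_i|. -/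
open Finset

/-- The 1-norm displacement of the row-balancing step equals the row-sum residual. -/
theorem rowBal_norm1_displacement
    {n m : ℕ} (X : Matrix (Fin n) (Fin m) ℝ) (p : Fin n → ℝ)
    (hX : ∀ i j, 0 ≤ X i j) (hrs : ∀ i, 0 < ∑ l, X i l) :
    norm1 (rowBal p X - X) = ∑ i, |(∑ j, X i j) - p i| := by
  unfold norm1
  refine Finset.sum_congr rfl fun i _ => ?_
  have hS := hrs i
  have h : ∀ j, |(rowBal p X - X) i j| = X i j * (|(∑ l, X i l) - p i| / ∑ l, X i l) := by
    intro j
    have e : (rowBal p X - X) i j = -(X i j * (((∑ l, X i l) - p i) / ∑ l, X i l)) := by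
      simp only [Matrix.sub_apply, rowBal]
      field_simp
      ring
    rw [e, abs_neg, abs_mul, abs_div, abs_of_nonneg (hX i j), abs_of_pos hS]
  simp only [h]
  rw [← Finset.sum_mul]
  field_simp
end

section
/- Let n, m ≥ 2, let X ∈ ℝ^{n×m} have nonnegative entries and strictly positive column sums, let p ∈ ℝ^n have strictly positive entries with ∑_{j=1}^m x_{ij} = p_i for every i, and let q ∈ ℝ^m have strictly positive entries with ∑_{j=1}^m q_j = ∑_{i=1}^n ∑_{j=1}^m x_{ij}. Define X'' by X''_{ij} = q_j x_{ij}/(∑_{k=1}^n x_{kj}). Then V(X'') ≤ (1 − ε_p(X))·V(X). -/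
open Finset

lemma epsP_le_aux {n m : ℕ} (X : Matrix (Fin n) (Fin m) ℝ)
    (hX : ∀ i j, 0 ≤ X i j) (hcs : ∀ j, 0 < ∑ k, X k j)
    (I : Finset (Fin n)) (J : Finset (Fin m)) (h1 : I.Nonempty) (h2 : I ≠ Finset.univ)
    (h3 : J.Nonempty) (h4 : J ≠ Finset.univ) :
    ∃ A B : ℝ, epsP X ≤ A + B ∧ (∀ j ∈ J, A ≤ ∑ i ∈ Iᶜ, X i j / ∑ k, X k j) ∧
      (∀ j ∉ J, B ≤ ∑ i ∈ I, X i j / ∑ k, X k j) := by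
  have hnn : ∀ (I : Finset (Fin n)) (j : Fin m), 0 ≤ ∑ i ∈ I, X i j / ∑ k, X k j :=
    fun I j => Finset.sum_nonneg fun i _ => div_nonneg (hX i j) (hcs j).le
  refine ⟨_, _, csInf_le ⟨0, ?_⟩ ⟨I, J, h1, h2, h3, h4, rfl⟩, ?_, ?_⟩
  · rintro v ⟨I, J, -, -, -, -, rfl⟩
    apply add_nonneg <;> apply Real.sInf_nonneg <;> rintro _ ⟨j, -, rfl⟩ <;> exact hnn _ j
  · intro j hj
    refine csInf_le ⟨0, ?_⟩ ⟨j, by simpa using hj, rfl⟩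
    rintro _ ⟨j, -, rfl⟩; exact hnn _ j
  · intro j hj
    refine csInf_le ⟨0, ?_⟩ ⟨j, by simpa using hj, rfl⟩
    rintro _ ⟨j, -, rfl⟩; exact hnn _ j

/-- A zero-sum vector: sum of absolute values is twice the positive part. -/
lemma sum_abs_aux {k : ℕ} (d : Fin k → ℝ) (hd : ∑ j, d j = 0) :
    ∑ j, |d j| = 2 * ∑ j ∈ univ.filter (fun j => 0 < d j), d j := by
  have : ∑ j, |d j| = ∑ j, (2 * (if 0 < d j then d j else 0) - d j) := by
    refine Finset.sum_congr rfl fun j _ => ?_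
    split_ifs with h
    · rw [abs_of_pos h]; ring
    · rw [abs_of_nonpos (not_lt.1 h)]; ring
  rw [this, Finset.sum_sub_distrib, hd, ← Finset.mul_sum, Finset.sum_filter]; ring

/-- Key contraction estimate: if the rows of X are already balanced, the column-balancing
step contracts the Lyapunov function by the factor (1 − ε_p(X)). -/
theorem colBal_lyap_contraction
    {n m : ℕ} (hn : 2 ≤ n) (hm : 2 ≤ m)
    (X : Matrix (Fin n) (Fin m) ℝ) (p : Fin n → ℝ) (q : Fin m → ℝ)
    (hX : ∀ i j, 0 ≤ X i j) (hcs : ∀ j, 0 < ∑ k, X k j)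
    (hp : ∀ i, 0 < p i) (hrows : ∀ i, ∑ j, X i j = p i)
    (hq : ∀ j, 0 < q j) (hqsum : ∑ j, q j = ∑ i, ∑ j, X i j) :
    lyap p q (colBal q X) ≤ (1 - epsP X) * lyap p q X := by
  classical
  set w : Fin n → Fin m → ℝ := fun i j => X i j / ∑ k, X k j with hw
  set d : Fin m → ℝ := fun j => q j - ∑ k, X k j with hd
  set r : Fin n → ℝ := fun i => ∑ j, w i j * d j with hr
  have hw1 : ∀ j, ∑ i, w i j = 1 := by
    intro j
    simp only [hw]
    rw [← Finset.sum_div, div_self (hcs j).ne']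
  have hd0 : ∑ j, d j = 0 := by
    simp only [hd]
    rw [Finset.sum_sub_distrib, hqsum, Finset.sum_comm, sub_self]
  have hr0 : ∑ i, r i = 0 := by
    simp only [hr]
    rw [Finset.sum_comm, ← hd0]
    refine Finset.sum_congr rfl fun j _ => ?_
    rw [← Finset.sum_mul, hw1, one_mul]
  have hV : lyap p q X = ∑ j, |d j| := by
    unfold lyap
    rw [Finset.sum_eq_zero (fun i _ => by rw [hrows]; simp), zero_add]
    exact Finset.sum_congr rfl fun j _ => abs_sub_comm _ _
  have hV2 : lyap p q (colBal q X) = ∑ i, |r i| := by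
    unfold lyap colBal
    have h2 : ∑ j, |(∑ i, q j * X i j / ∑ k, X k j) - q j| = 0 := by
      refine Finset.sum_eq_zero fun j _ => ?_
      rw [← Finset.sum_div, ← Finset.mul_sum, mul_div_cancel_right₀ _ (hcs j).ne']
      simp
    rw [h2, add_zero]
    refine Finset.sum_congr rfl fun i _ => ?_
    congr 1
    rw [← hrows i, ← Finset.sum_sub_distrib]
    refine Finset.sum_congr rfl fun j _ => ?_
    simp only [hw, hd]
    have := (hcs j).ne'
    field_simp
  rw [hV, hV2]
  by_cases hdz : ∀ j, d j = 0
  · simp [hr, hdz]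
  set J := univ.filter (fun j => 0 < d j) with hJ
  have hJ1 : J.Nonempty := by
    by_contra h
    apply hdz
    have hle : ∀ j ∈ (univ : Finset (Fin m)), d j ≤ 0 := by
      intro j _
      by_contra hj
      exact h ⟨j, by simpa [hJ] using hj⟩
    intro j
    exact (Finset.sum_eq_zero_iff_of_nonpos hle).1 hd0 j (mem_univ j)
  have hJ2 : J ≠ univ := by
    intro h
    have : 0 < ∑ j, d j := by
      rw [← h]
      exact Finset.sum_pos (fun j hj => (by simpa [hJ] using hj)) hJ1
    linarith
  obtain ⟨I, hI1, hI2, hI⟩ : ∃ I : Finset (Fin n), I.Nonempty ∧ I ≠ univ ∧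
      ∑ i, |r i| = 2 * ∑ i ∈ I, r i := by
    by_cases h : (univ.filter (fun i => 0 < r i)).Nonempty
    · refine ⟨_, h, ?_, sum_abs_aux r hr0⟩
      intro h'
      have : 0 < ∑ i, r i := by
        rw [← h']
        exact Finset.sum_pos (fun j hj => (by simpa using hj)) h
      linarith
    · have hle : ∀ j ∈ (univ : Finset (Fin n)), r j ≤ 0 := by
        intro j _
        by_contra hj
        exact h ⟨j, by simpa using hj⟩
      have hz : ∀ i, r i = 0 := fun i =>
        (Finset.sum_eq_zero_iff_of_nonpos hle).1 hr0 i (mem_univ i)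
      refine ⟨{⟨0, by omega⟩}, by simp, ?_, by simp [hz]⟩
      intro h'
      have := mem_univ (⟨1, by omega⟩ : Fin n)
      rw [← h'] at this
      simp at this
  obtain ⟨A, B, hAB, hA, hB⟩ := epsP_le_aux X hX hcs I J hI1 hI2 hJ1 hJ2
  have hs : ∀ j, ∑ i ∈ I, w i j + ∑ i ∈ Iᶜ, w i j = 1 := fun j => by
    rw [Finset.sum_add_sum_compl, hw1]
  have hsum : ∑ i ∈ I, r i = ∑ j, (∑ i ∈ I, w i j) * d j := by
    simp only [hr]
    rw [Finset.sum_comm]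
    exact Finset.sum_congr rfl fun j _ => (Finset.sum_mul _ _ _).symm
  have hbd : ∑ j, (∑ i ∈ I, w i j) * d j ≤
      ∑ j, ((1 - A - B) * (if 0 < d j then d j else 0) + B * d j) := by
    refine Finset.sum_le_sum fun j _ => ?_
    split_ifs with h
    · have h1 : A ≤ ∑ i ∈ Iᶜ, w i j := hA j (by simpa [hJ] using h)
      have h2 := hs j
      nlinarith
    · have h1 : B ≤ ∑ i ∈ I, w i j := hB j (by simpa [hJ] using h)
      have := not_lt.1 h
      nlinarith
  rw [Finset.sum_add_distrib, ← Finset.mul_sum, ← Finset.mul_sum, hd0, ← Finset.sum_filter,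
    ← hJ] at hbd
  have hda := sum_abs_aux d hd0
  rw [← hJ] at hda
  have hpos : 0 ≤ ∑ j, |d j| := Finset.sum_nonneg fun j _ => abs_nonneg _
  rw [hI, hsum, hda]
  nlinarith
end

section
/- Let X ∈ ℝ^{n×m} have nonnegative entries with no zero row and no zero column, let p ∈ ℝ^n have strictly positive entries, and suppose V(X) < min_i p_i. Let X' be the row-balancing step applied to X, i.e. X'_{ij} = p_i x_{ij}/(∑_{l=1}^m x_{il}) (the column sums of X' are positive). Then for every nonempty subset Ĩ ⊆ {1,…,n} and every nonempty subset J̃ ⊆ {1,…,m}: min_{j∈J̃} ∑_{i∈Ĩ} X'_{ij}/(∑_{k=1}^n X'_{kj}) ≥ ((min_i p_i − V(X))/(min_i p_i + V(X))) · min_{j∈J̃} ∑_{i∈Ĩ} x_{ij}/(∑_{k=1}^n x_{kj}). -/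
open Finset

/-- The row-balancing step nearly preserves the within-column proportions: every
group minimum of column shares decreases at most by the factor
(min p − V(X))/(min p + V(X)). -/
theorem rowBal_column_share_estimate
    {n m : ℕ} (X : Matrix (Fin n) (Fin m) ℝ) (p : Fin n → ℝ) (q : Fin m → ℝ)
    (hX : ∀ i j, 0 ≤ X i j)
    (hrow : ∀ i, ∃ j, X i j ≠ 0)
    (hcol : ∀ j, ∃ i, X i j ≠ 0)
    (hp : ∀ i, 0 < p i)
    (hV : lyap p q X < ⨅ i, p i) :
    ∀ (I : Finset (Fin n)) (J : Finset (Fin m)) (hI : I.Nonempty) (hJ : J.Nonempty),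
      ((⨅ i, p i) - lyap p q X) / ((⨅ i, p i) + lyap p q X) *
          J.inf' hJ (fun j => ∑ i ∈ I, X i j / ∑ k, X k j) ≤
        J.inf' hJ (fun j => ∑ i ∈ I, rowBal p X i j / ∑ k, rowBal p X k j) := by
  intro I J hI hJ
  set P := ⨅ i, p i with hPdef
  set V := lyap p q X with hVdef
  have hV0 : 0 ≤ V := by
    rw [hVdef]; unfold lyap; positivity
  have hP0 : 0 < P := lt_of_le_of_lt hV0 hV
  have hPp : ∀ i, P ≤ p i := fun i => ciInf_le (Set.finite_range p).bddBelow i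
  have hr : ∀ i, 0 < ∑ j, X i j := by
    intro i
    obtain ⟨j, hj⟩ := hrow i
    exact Finset.sum_pos' (fun j _ => hX i j)
      ⟨j, Finset.mem_univ _, lt_of_le_of_ne (hX i j) (Ne.symm hj)⟩
  have hc : ∀ j, 0 < ∑ i, X i j := by
    intro j
    obtain ⟨i, hi⟩ := hcol j
    exact Finset.sum_pos' (fun i _ => hX i j)
      ⟨i, Finset.mem_univ _, lt_of_le_of_ne (hX i j) (Ne.symm hi)⟩
  have hdev : ∀ i, |(∑ j, X i j) - p i| ≤ V := by
    intro i
    have h1 : |(∑ j, X i j) - p i| ≤ ∑ i, |(∑ j, X i j) - p i| :=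
      Finset.single_le_sum (f := fun i => |(∑ j, X i j) - p i|)
        (fun i _ => abs_nonneg _) (Finset.mem_univ i)
    have h2 : 0 ≤ ∑ j, |(∑ i, X i j) - q j| := Finset.sum_nonneg fun j _ => abs_nonneg _
    rw [hVdef]; unfold lyap; linarith
  have hPV : 0 < P - V := by linarith
  have hPV' : 0 < P + V := by linarith
  have hlo : ∀ i j, P / (P + V) * X i j ≤ rowBal p X i j := by
    intro i j
    have hd := abs_le.mp (hdev i)
    have : P / (P + V) ≤ p i / ∑ l, X i l := by
      rw [div_le_div_iff₀ hPV' (hr i)]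
      nlinarith [mul_nonneg hP0.le (sub_nonneg.2 hd.2), mul_nonneg hV0 (sub_nonneg.2 (hPp i))]
    calc _ ≤ (p i / ∑ l, X i l) * X i j := mul_le_mul_of_nonneg_right this (hX i j)
      _ = _ := by unfold rowBal; ring
  have hhi : ∀ i j, rowBal p X i j ≤ P / (P - V) * X i j := by
    intro i j
    have hd := abs_le.mp (hdev i)
    have : p i / (∑ l, X i l) ≤ P / (P - V) := by
      rw [div_le_div_iff₀ (hr i) hPV]
      nlinarith [mul_nonneg hP0.le (neg_le_iff_add_nonneg.1 hd.1),
        mul_nonneg hV0 (sub_nonneg.2 (hPp i))]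
    calc _ = (p i / ∑ l, X i l) * X i j := by unfold rowBal; ring
      _ ≤ _ := mul_le_mul_of_nonneg_right this (hX i j)
  refine Finset.le_inf' _ _ fun j hj => ?_
  refine (mul_le_mul_of_nonneg_left (Finset.inf'_le _ hj) (by positivity)).trans ?_
  rw [← Finset.sum_div, ← Finset.sum_div]
  have h1 : P / (P + V) * ∑ i ∈ I, X i j ≤ ∑ i ∈ I, rowBal p X i j := by
    rw [Finset.mul_sum]; exact Finset.sum_le_sum fun i _ => hlo i j
  have h2 : P / (P + V) * ∑ i, X i j ≤ ∑ i, rowBal p X i j := by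
    rw [Finset.mul_sum]; exact Finset.sum_le_sum fun i _ => hlo i j
  have h3 : ∑ i, rowBal p X i j ≤ P / (P - V) * ∑ i, X i j := by
    rw [Finset.mul_sum]; exact Finset.sum_le_sum fun i _ => hhi i j
  have hcj := hc j
  have hc' : 0 < ∑ i, rowBal p X i j := lt_of_lt_of_le (by positivity) h2
  have hs : 0 ≤ ∑ i ∈ I, X i j := Finset.sum_nonneg fun i _ => hX i j
  have hs' : 0 ≤ ∑ i ∈ I, rowBal p X i j := le_trans (by positivity) h1
  calc _ = (P / (P + V) * ∑ i ∈ I, X i j) / (P / (P - V) * ∑ i, X i j) := by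
        field_simp
    _ ≤ _ := div_le_div₀ hs' h1 hc' h3
end

section
/- Let A ∈ ℝ^{n×m}, p ∈ ℝ^n, q ∈ ℝ^m with ∑_{i=1}^n p_i = ∑_{j=1}^m q_j = s. Set ξ_i = ∑_{j=1}^m a_{ij}, η_j = ∑_{i=1}^n a_{ij}, ζ = ∑_{i=1}^n ∑_{j=1}^m a_{ij}, and define X̂ by X̂_{ij} = a_{ij} − (1/m)(ξ_i − p_i) − (1/n)(η_j − q_j) + (1/(nm))(ζ − s). Then X̂ satisfies ∑_{j=1}^m X̂_{ij} = p_i for all i and ∑_{i=1}^n X̂_{ij} = q_j for all j, and X̂ is the unique minimizer of ∑_{i,j}(x_{ij} − a_{ij})² over all X ∈ ℝ^{n×m} with ∑_{j=1}^m x_{ij} = p_i for all i and ∑_{i=1}^n x_{ij} = q_j for all j. -/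
open Finset

/-- The analytic solution `X̂` of the problem with only the transport equality constraints. -/
noncomputable def Xhat {n m : ℕ} (A : Matrix (Fin n) (Fin m) ℝ) (p : Fin n → ℝ)
    (q : Fin m → ℝ) : Matrix (Fin n) (Fin m) ℝ :=
  fun i j =>
    A i j - (1 / (m : ℝ)) * ((∑ l, A i l) - p i) - (1 / (n : ℝ)) * ((∑ k, A k j) - q j)
      + (1 / ((n : ℝ) * (m : ℝ))) * ((∑ k, ∑ l, A k l) - ∑ i, p i)

/-- Appendix: `X̂` satisfies the transport equality constraints and is the unique minimizer
of the squared Frobenius distance to `A` under those constraints. -/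
theorem Xhat_is_unique_minimizer
    {n m : ℕ} (hn : 0 < n) (hm : 0 < m)
    (A : Matrix (Fin n) (Fin m) ℝ) (p : Fin n → ℝ) (q : Fin m → ℝ)
    (hbal : ∑ i, p i = ∑ j, q j) :
    (∀ i, ∑ j, Xhat A p q i j = p i) ∧ (∀ j, ∑ i, Xhat A p q i j = q j) ∧
    ∀ Y : Matrix (Fin n) (Fin m) ℝ,
      (∀ i, ∑ j, Y i j = p i) → (∀ j, ∑ i, Y i j = q j) →
      (∑ i, ∑ j, (Xhat A p q i j - A i j) ^ 2 ≤ ∑ i, ∑ j, (Y i j - A i j) ^ 2) ∧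
      (Y ≠ Xhat A p q →
        ∑ i, ∑ j, (Xhat A p q i j - A i j) ^ 2 < ∑ i, ∑ j, (Y i j - A i j) ^ 2) := by
  have hn' : (n : ℝ) ≠ 0 := by positivity
  have hm' : (m : ℝ) ≠ 0 := by positivity
  have hrow : ∀ i, ∑ j, Xhat A p q i j = p i := by
    intro i
    have hc : ∑ j, ∑ k, A k j = ∑ k, ∑ l, A k l := Finset.sum_comm
    simp only [Xhat, Finset.sum_add_distrib, Finset.sum_sub_distrib, ← Finset.mul_sum,
      Finset.sum_const, Finset.card_univ, Fintype.card_fin, nsmul_eq_mul, hc, hbal]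
    field_simp
    ring
  have hcol : ∀ j, ∑ i, Xhat A p q i j = q j := by
    intro j
    simp only [Xhat, Finset.sum_add_distrib, Finset.sum_sub_distrib, ← Finset.mul_sum,
      Finset.sum_const, Finset.card_univ, Fintype.card_fin, nsmul_eq_mul]
    field_simp
    ring
  refine ⟨hrow, hcol, ?_⟩
  intro Y hYr hYc
  obtain ⟨u, v, huv⟩ : ∃ (u : Fin n → ℝ) (v : Fin m → ℝ),
      ∀ i j, Xhat A p q i j - A i j = u i + v j :=
    ⟨fun i => - ((1 / (m : ℝ)) * ((∑ l, A i l) - p i))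
        + (1 / ((n : ℝ) * (m : ℝ))) * ((∑ k, ∑ l, A k l) - ∑ i, p i),
      fun j => - ((1 / (n : ℝ)) * ((∑ k, A k j) - q j)), fun i j => by
        simp only [Xhat]; ring⟩
  generalize Xhat A p q = X at *
  have h1 : ∑ i, ∑ j, u i * (Y i j - X i j) = 0 := by
    simp only [← Finset.mul_sum, Finset.sum_sub_distrib, hYr, hrow, sub_self, mul_zero,
      Finset.sum_const_zero]
  have h2 : ∑ i, ∑ j, v j * (Y i j - X i j) = 0 := by
    rw [Finset.sum_comm]
    simp only [← Finset.mul_sum, Finset.sum_sub_distrib, hYc, hcol, sub_self, mul_zero,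
      Finset.sum_const_zero]
  have key : ∑ i, ∑ j, (Y i j - A i j) ^ 2
      = ∑ i, ∑ j, (X i j - A i j) ^ 2 + ∑ i, ∑ j, (Y i j - X i j) ^ 2 := by
    have : ∑ i, ∑ j, (Y i j - A i j) ^ 2
      = ∑ i, ∑ j, (X i j - A i j) ^ 2 + ∑ i, ∑ j, (Y i j - X i j) ^ 2
        + 2 * ∑ i, ∑ j, u i * (Y i j - X i j) + 2 * ∑ i, ∑ j, v j * (Y i j - X i j) := by
      simp only [Finset.mul_sum, ← Finset.sum_add_distrib]
      refine Finset.sum_congr rfl fun i _ => Finset.sum_congr rfl fun j _ => ?_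
      linear_combination (2 * (Y i j - X i j)) * huv i j
    rw [this, h1, h2]; ring
  have hnn : ∀ i, 0 ≤ ∑ j, (Y i j - X i j) ^ 2 := fun i =>
    Finset.sum_nonneg fun j _ => sq_nonneg _
  have hnn2 : 0 ≤ ∑ i, ∑ j, (Y i j - X i j) ^ 2 := Finset.sum_nonneg fun i _ => hnn i
  refine ⟨by linarith, fun hne => ?_⟩
  have : ∑ i, ∑ j, (Y i j - X i j) ^ 2 ≠ 0 := by
    intro h0
    apply hne
    ext i j
    have ha := (Finset.sum_eq_zero_iff_of_nonneg (fun i _ => hnn i)).1 h0 i (Finset.mem_univ i)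
    have hb := (Finset.sum_eq_zero_iff_of_nonneg (fun j _ => sq_nonneg _)).1 ha j
      (Finset.mem_univ j)
    exact sub_eq_zero.1 (pow_eq_zero_iff two_ne_zero |>.1 hb)
  have := lt_of_le_of_ne hnn2 this.symm
  linarith
end

section
/- Let n, m ≥ 2 and let A ∈ ℝ^{n×m} have nonnegative entries with no zero column. For each j let b_{ij} = a_{ij}/(∑_{k=1}^n a_{kj}), and for κ ∈ {1,…,n−1} let σ_j(κ) denote the sum of the κ smallest values among b_{1j},…,b_{nj}. Then ε_p(A) ≥ min_{κ=1,…,⌊n/2⌋} ( min_{j=1,…,m} σ_j(κ) + min_{j=1,…,m} σ_j(n−κ) ). -/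
open Finset

/-- `σ_j(κ)`: the sum of the `κ` smallest column shares `a_{ij}/(∑ₖ a_{kj})` in column `j`,
expressed as the minimum over all `κ`-element subsets of row indices. -/
noncomputable def sigLow {n m : ℕ} (A : Matrix (Fin n) (Fin m) ℝ) (j : Fin m) (κ : ℕ) : ℝ :=
  sInf { w : ℝ | ∃ S : Finset (Fin n), S.card = κ ∧ w = ∑ i ∈ S, A i j / ∑ k, A k j }

lemma sigLow_le {n m : ℕ} (A : Matrix (Fin n) (Fin m) ℝ) (hA : ∀ i j, 0 ≤ A i j)
    (j : Fin m) (S : Finset (Fin n)) :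
    sigLow A j S.card ≤ ∑ i ∈ S, A i j / ∑ k, A k j := by
  apply csInf_le
  · refine ⟨0, ?_⟩
    rintro w ⟨T, -, rfl⟩
    exact Finset.sum_nonneg fun i _ => div_nonneg (hA i j) (Finset.sum_nonneg fun k _ => hA k j)
  · exact ⟨S, rfl, rfl⟩

lemma sigLow_nonneg {n m : ℕ} (A : Matrix (Fin n) (Fin m) ℝ) (hA : ∀ i j, 0 ≤ A i j)
    (j : Fin m) (κ : ℕ) : 0 ≤ sigLow A j κ := by
  apply Real.sInf_nonneg
  rintro w ⟨T, -, rfl⟩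
  exact Finset.sum_nonneg fun i _ => div_nonneg (hA i j) (Finset.sum_nonneg fun k _ => hA k j)

lemma iInf_sigLow_le {n m : ℕ} (A : Matrix (Fin n) (Fin m) ℝ) (hA : ∀ i j, 0 ≤ A i j)
    (S : Finset (Fin n)) (J : Finset (Fin m)) (hJ : J.Nonempty) :
    (⨅ j, sigLow A j S.card) ≤
      sInf ((fun j => ∑ i ∈ S, A i j / ∑ k, A k j) '' (J : Set (Fin m))) := by
  apply le_csInf
  · exact (Finset.coe_nonempty.mpr hJ).image _
  · rintro _ ⟨j, -, rfl⟩
    exact (ciInf_le (Set.finite_range _).bddBelow j).trans (sigLow_le A hA j S)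

/-- Remark 1: effective lower bound for `ε_p(A)`. -/
theorem epsP_lower_bound
    {n m : ℕ} (hn : 2 ≤ n) (hm : 2 ≤ m)
    (A : Matrix (Fin n) (Fin m) ℝ)
    (hA : ∀ i j, 0 ≤ A i j)
    (hcol : ∀ j, ∃ i, A i j ≠ 0) :
    sInf { v : ℝ | ∃ κ : ℕ, 1 ≤ κ ∧ κ ≤ n / 2 ∧
        v = (⨅ j, sigLow A j κ) + (⨅ j, sigLow A j (n - κ)) } ≤ epsP A := by
  have hbdd : BddBelow { v : ℝ | ∃ κ : ℕ, 1 ≤ κ ∧ κ ≤ n / 2 ∧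
        v = (⨅ j, sigLow A j κ) + (⨅ j, sigLow A j (n - κ)) } := by
    refine ⟨0, ?_⟩
    rintro v ⟨κ, -, -, rfl⟩
    exact add_nonneg (Real.iInf_nonneg fun j => sigLow_nonneg A hA j _)
      (Real.iInf_nonneg fun j => sigLow_nonneg A hA j _)
  unfold epsP
  apply le_csInf
  · refine ⟨_, {⟨0, by omega⟩}, {⟨0, by omega⟩}, Finset.singleton_nonempty _, ?_,
      Finset.singleton_nonempty _, ?_, rfl⟩
    · intro h
      have := congrArg Finset.card h
      simp at this
      omega
    · intro h
      have := congrArg Finset.card h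
      simp at this
      omega
  · rintro v ⟨I, J, hI, hI', hJ, hJ', rfl⟩
    have hJc : Jᶜ.Nonempty := by
      rw [Finset.nonempty_iff_ne_empty]
      simpa using hJ'
    have h1 := iInf_sigLow_le A hA Iᶜ J hJ
    have h2 := iInf_sigLow_le A hA I Jᶜ hJc
    have hc : Iᶜ.card = n - I.card := by simp [Finset.card_compl]
    have hpos := hI.card_pos
    have hlt : I.card < n := by
      have := Finset.card_lt_card (Finset.ssubset_univ_iff.mpr hI')
      simpa using this
    rw [hc] at h1
    by_cases hk : I.card ≤ n / 2
    · refine (csInf_le hbdd ⟨I.card, hpos, hk, rfl⟩).trans ?_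
      linarith
    · refine (csInf_le hbdd ⟨n - I.card, by omega, by omega, rfl⟩).trans ?_
      rw [show n - (n - I.card) = I.card by omega]
      linarith
end

section
/- Let C ⊆ ℝ^{n×m} be a convex set, let A ∈ ℝ^{n×m}, and suppose X* ∈ C satisfies ‖X* − A‖₂ ≤ ‖Y − A‖₂ for all Y ∈ C. Then for every X' ∈ C and every X ∈ ℝ^{n×m}: ‖X − X*‖₂² ≤ ‖X − A‖₂² − ‖X* − A‖₂² + 2·‖X* − A‖₂·‖X' − X‖₂. -/
theorem frob_sq {n m : ℕ} (X : Matrix (Fin n) (Fin m) ℝ) :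
    frob X ^ 2 = ∑ i, ∑ j, (X i j) ^ 2 :=
  Real.sq_sqrt (Finset.sum_nonneg fun i _ => Finset.sum_nonneg fun j _ => sq_nonneg _)

theorem frob_add_smul_sq {n m : ℕ} (P Q : Matrix (Fin n) (Fin m) ℝ) (t : ℝ) :
    frob (P + t • Q) ^ 2 =
      frob P ^ 2 + 2 * t * (∑ i, ∑ j, P i j * Q i j) + t ^ 2 * frob Q ^ 2 := by
  simp only [frob_sq, Finset.mul_sum, ← Finset.sum_add_distrib]
  refine Finset.sum_congr rfl fun i _ => Finset.sum_congr rfl fun j _ => ?_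
  simp only [Matrix.add_apply, Matrix.smul_apply, smul_eq_mul]
  ring

theorem frob_cs {n m : ℕ} (P Q : Matrix (Fin n) (Fin m) ℝ) :
    ∑ i, ∑ j, P i j * Q i j ≤ frob P * frob Q := by
  have h := Real.sum_mul_le_sqrt_mul_sqrt (Finset.univ : Finset (Fin n × Fin m))
    (fun p => P p.1 p.2) (fun p => Q p.1 p.2)
  simpa only [Fintype.sum_prod_type, frob] using h

/-- Projection-type inequality: if `X*` minimizes the Frobenius distance to `A` over a
convex set `C`, then for every `X' ∈ C` and every `X`,
`‖X − X*‖₂² ≤ ‖X − A‖₂² − ‖X* − A‖₂² + 2‖X* − A‖₂‖X' − X‖₂`. -/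
theorem dist_sq_bound_of_min_over_convex
    {n m : ℕ} (C : Set (Matrix (Fin n) (Fin m) ℝ)) (hC : Convex ℝ C)
    (A Xstar : Matrix (Fin n) (Fin m) ℝ) (hXstar : Xstar ∈ C)
    (hmin : ∀ Y ∈ C, frob (Xstar - A) ≤ frob (Y - A)) :
    ∀ X' ∈ C, ∀ X : Matrix (Fin n) (Fin m) ℝ,
      frob (X - Xstar) ^ 2 ≤
        frob (X - A) ^ 2 - frob (Xstar - A) ^ 2 +
          2 * frob (Xstar - A) * frob (X' - X) := by
  intro X' hX' X
  have hpos : 0 ≤ ∑ i, ∑ j, (Xstar - A) i j * (X' - Xstar) i j := by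
    by_contra hb
    push Not at hb
    have key : ∀ t : ℝ, 0 ≤ t → t ≤ 1 →
        0 ≤ 2 * t * (∑ i, ∑ j, (Xstar - A) i j * (X' - Xstar) i j)
          + t ^ 2 * frob (X' - Xstar) ^ 2 := by
      intro t h0 h1
      have hm := hmin _ (hC.add_smul_sub_mem hXstar hX' ⟨h0, h1⟩)
      have e : Xstar + t • (X' - Xstar) - A = (Xstar - A) + t • (X' - Xstar) := by abel
      rw [e] at hm
      have hn : 0 ≤ frob (Xstar - A) := Real.sqrt_nonneg _
      have h2 := pow_le_pow_left₀ hn hm 2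
      rw [frob_add_smul_sq] at h2
      linarith
    generalize (∑ i, ∑ j, (Xstar - A) i j * (X' - Xstar) i j) = b at hb key
    have hd : 0 ≤ frob (X' - Xstar) ^ 2 := sq_nonneg _
    generalize frob (X' - Xstar) ^ 2 = d at hd key
    have hdb : 0 < d - b := by linarith
    have ht : 0 < -b / (d - b) := div_pos (by linarith) hdb
    have h := key (-b / (d - b)) ht.le (by rw [div_le_one hdb]; linarith)
    have e : -b / (d - b) * (d - b) = -b := div_mul_cancel₀ _ hdb.ne'
    generalize -b / (d - b) = t at ht h e
    have h3 : 0 ≤ 2 * b + t * d := by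
      by_contra hn
      push Not at hn
      nlinarith [mul_neg_of_pos_of_neg ht hn]
    nlinarith [mul_neg_of_pos_of_neg ht hb]
  have hcs := frob_cs (Xstar - A) (X' - X)
  have h1 := frob_add_smul_sq (Xstar - A) (X - Xstar) 1
  have e : (Xstar - A) + (1 : ℝ) • (X - Xstar) = X - A := by rw [one_smul]; abel
  rw [e] at h1
  have e2 : ∑ i, ∑ j, (Xstar - A) i j * (X - Xstar) i j =
      (∑ i, ∑ j, (Xstar - A) i j * (X' - Xstar) i j)
        - ∑ i, ∑ j, (Xstar - A) i j * (X' - X) i j := by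
    simp only [← Finset.sum_sub_distrib]
    refine Finset.sum_congr rfl fun i _ => Finset.sum_congr rfl fun j _ => ?_
    simp only [Matrix.sub_apply]
    ring
  rw [e2] at h1
  linarith
end
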